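/- arXiv:1002.3448 — 2 statements merged into one kernel-verified Lean document; each statement's English description precedes it below -/
import Mathlib

section
/- Let Q be a probability distribution on ℝ^d with ∫ ‖x‖ Q(dx) < ∞ and csupp(Q) having nonempty interior. For a vector a ∈ ℝ^d and a nonsingular real d×d matrix B, let Q_{a,B} be the distribution of a + BX when X ∼ Q (the pushforward of Q under x ↦ a + Bx). Then Q_{a,B} also has finite first moment and convex support with nonempty interior, L(Q_{a,B}) = L(Q) − log|det B|, and ψ(x | Q_{a,B}) = ψ(B^{−1}(x − a) | Q) − log|det B| for all x ∈ ℝ^d. -/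
open MeasureTheory Filter Topology Set
open scoped ENNReal RealInnerProductSpace BoundedContinuousFunction

noncomputable section

/-- Truncation of an extended real number to `ℝ≥0∞`. -/
def EReal.toENN (x : EReal) : ℝ≥0∞ := if x = ⊤ then ⊤ else ENNReal.ofReal x.toReal

/-- The real-valued exponential of an extended real number (`⊤` is sent to `0`,
but this value is never used for functions in the class `Φ`). -/
def EReal.expR (x : EReal) : ℝ := (EReal.exp x).toReal

/-- The class `Φ(d)`: upper semicontinuous, concave functions `φ : E → [-∞, ∞)`
which are coercive in the sense that `φ x → -∞` as `‖x‖ → ∞`. -/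
def IsPhi {E : Type*} [NormedAddCommGroup E] [NormedSpace ℝ E] (φ : E → EReal) : Prop :=
  UpperSemicontinuous φ ∧ (∀ x, φ x ≠ ⊤) ∧
  (∀ x y : E, ∀ a b : ℝ, 0 < a → 0 < b → a + b = 1 →
    (a : EReal) * φ x + (b : EReal) * φ y ≤ φ (a • x + b • y)) ∧
  Tendsto φ (Filter.comap (fun x : E => ‖x‖) atTop) (𝓝 ⊥)

/-- The integral of an `EReal`-valued function with respect to a measure,
defined as the difference of the integrals of the positive and negative parts. -/
def eint {E : Type*} [MeasurableSpace E] (Q : Measure E) (φ : E → EReal) : EReal :=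
  ((∫⁻ x, (φ x).toENN ∂Q : ℝ≥0∞) : EReal) - ((∫⁻ x, (-(φ x)).toENN ∂Q : ℝ≥0∞) : EReal)

/-- The log-likelihood-type functional `L(φ, Q) = ∫ φ dQ - ∫ e^{φ(x)} dx + 1`. -/
def Lfun {E : Type*} [NormedAddCommGroup E] [NormedSpace ℝ E] [MeasureSpace E]
    (φ : E → EReal) (Q : Measure E) : EReal :=
  eint Q φ - ((∫⁻ x, EReal.exp (φ x) : ℝ≥0∞) : EReal) + 1

/-- The profile log-likelihood `L(Q) = sup_{φ ∈ Φ} L(φ, Q)`. -/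
def Lprof {E : Type*} [NormedAddCommGroup E] [NormedSpace ℝ E] [MeasureSpace E]
    (Q : Measure E) : EReal :=
  ⨆ φ ∈ {φ : E → EReal | IsPhi φ}, Lfun φ Q

/-- The convex support of a measure: the intersection of all closed convex sets of full
measure. -/
def csupp {E : Type*} [NormedAddCommGroup E] [NormedSpace ℝ E] [MeasurableSpace E]
    (Q : Measure E) : Set E :=
  ⋂₀ {C : Set E | IsClosed C ∧ Convex ℝ C ∧ Q C = 1}

/-- `ψ` is the (a) maximizer of `L(·, Q)` over `Φ`, i.e. `ψ = ψ(·|Q)`. -/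
def IsMLE {E : Type*} [NormedAddCommGroup E] [NormedSpace ℝ E] [MeasureSpace E]
    (Q : Measure E) (ψ : E → EReal) : Prop :=
  IsPhi ψ ∧ ∀ φ : E → EReal, IsPhi φ → Lfun φ Q ≤ Lfun ψ Q

/-- Weak convergence of a sequence of measures. -/
def WConv {E : Type*} [NormedAddCommGroup E] [MeasurableSpace E]
    (Qn : ℕ → Measure E) (Q : Measure E) : Prop :=
  ∀ g : E →ᵇ ℝ, Tendsto (fun n => ∫ x, g x ∂(Qn n)) atTop (𝓝 (∫ x, g x ∂Q))

/-- The Mallows (Wasserstein-1, Kantorovich–Rubinstein) distance. -/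
def D1 {E : Type*} [NormedAddCommGroup E] [MeasurableSpace E] (Q Q' : Measure E) : ℝ :=
  sSup {r : ℝ | ∃ h : E → ℝ, LipschitzWith 1 h ∧ r = |(∫ x, h x ∂Q) - ∫ x, h x ∂Q'|}

/-- The bounded Lipschitz distance. -/
def DBL (Q Q' : Measure ℝ) : ℝ :=
  sSup {r : ℝ | ∃ h : ℝ → ℝ, (∀ x, |h x| ≤ 1) ∧ LipschitzWith 1 h ∧
    r = |(∫ x, h x ∂Q) - ∫ x, h x ∂Q'|}

/-- The Kolmogorov–Smirnov distance. -/
def DKS (Q Q' : Measure ℝ) : ℝ :=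
  ⨆ t : ℝ, |(Q' (Set.Iic t)).toReal - (Q (Set.Iic t)).toReal|

/-- Convolution of two measures. -/
def mconv {E : Type*} [NormedAddCommGroup E] [MeasurableSpace E] (Q R : Measure E) : Measure E :=
  (Q.prod R).map (fun p => p.1 + p.2)

/-- The empirical measure of a finite tuple of real numbers. -/
def empQ {n : ℕ} (v : Fin n → ℝ) : Measure ℝ :=
  ((n : ℝ≥0∞))⁻¹ • ∑ i, Measure.dirac (v i)

end

theorem eReal_continuous_add_coe (c : ℝ) : Continuous fun u : EReal => u + (c : EReal) := by
  rw [continuous_iff_continuousAt]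
  intro u
  have h := EReal.continuousAt_add (p := (u, (c : EReal))) (Or.inr (EReal.coe_ne_bot c))
    (Or.inr (EReal.coe_ne_top c))
  exact ContinuousAt.comp (f := fun u : EReal => (u, (c : EReal))) h (by fun_prop)

theorem toENN_shift (u : EReal) (c : ℝ) :
    (u + c).toENN + ((-u).toENN + ENNReal.ofReal (-c)) =
      u.toENN + ((-(u + c)).toENN + ENNReal.ofReal c) := by
  induction u with
  | bot => simp [EReal.toENN]
  | top => simp [EReal.toENN]
  | coe u =>
    have h (r : ℝ) : (r : EReal).toENN = ENNReal.ofReal r := by simp [EReal.toENN]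
    rw [← EReal.coe_add, ← EReal.coe_neg, ← EReal.coe_neg, h, h, h, h]
    rcases le_total 0 u with h1 | h1 <;> rcases le_total 0 c with h2 | h2 <;>
      rcases le_total 0 (u + c) with h3 | h3 <;>
      simp only [ENNReal.ofReal_of_nonpos, h1, h2, h3, neg_nonpos,
        add_zero, zero_add] <;>
      (try rw [← ENNReal.ofReal_add (by linarith) (by linarith)]) <;>
      (try rw [← ENNReal.ofReal_add (by linarith) (by linarith)]) <;>
      (try rw [← ENNReal.ofReal_add (by linarith) (by linarith)]) <;>
      first
        | (congr 1; ring1)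
        | (congr 1; linarith)
        | (rw [ENNReal.ofReal_of_nonpos (by linarith)])
        | (symm; rw [ENNReal.ofReal_of_nonpos (by linarith)])

theorem toENN_add_le (u : EReal) (c : ℝ) :
    (u + c).toENN ≤ u.toENN + ENNReal.ofReal c := by
  induction u with
  | bot => simp [EReal.toENN]
  | top => simp [EReal.toENN]
  | coe u =>
    have h (r : ℝ) : (r : EReal).toENN = ENNReal.ofReal r := by simp [EReal.toENN]
    rw [← EReal.coe_add, h, h]
    exact ENNReal.ofReal_add_le

theorem toENN_measurable : Measurable EReal.toENN := by
  have : EReal.toENN = EReal.toENNReal := rfl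
  rw [this]
  exact measurable_ereal_toENNReal

theorem lint_toENN_add_le {E : Type*} [MeasurableSpace E] (Q : Measure E) [IsProbabilityMeasure Q]
    (φ : E → EReal) (c : ℝ) :
    ∫⁻ x, (φ x + c).toENN ∂Q ≤ ∫⁻ x, (φ x).toENN ∂Q + ENNReal.ofReal c := by
  calc _ ≤ ∫⁻ x, ((φ x).toENN + ENNReal.ofReal c) ∂Q :=
        lintegral_mono fun x => toENN_add_le _ _
    _ = _ := by rw [lintegral_add_right _ measurable_const]; simp

theorem neg_add_coe' (u : EReal) (c : ℝ) : -(u + c) = -u + ((-c : ℝ) : EReal) := by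
  rw [EReal.neg_add (Or.inr (EReal.coe_ne_top c)) (Or.inr (EReal.coe_ne_bot c)), EReal.coe_neg]
  rfl

theorem eint_shift {E : Type*} [MeasurableSpace E] (Q : Measure E) [IsProbabilityMeasure Q]
    (φ : E → EReal) (hφ : Measurable φ) (c : ℝ) :
    eint Q (fun x => φ x + c) = eint Q φ + c := by
  have hc := (eReal_continuous_add_coe c).measurable
  have h1 := lint_toENN_add_le Q φ c
  have h2 := lint_toENN_add_le Q (fun x => φ x + c) (-c)
  have h3 := lint_toENN_add_le Q (fun x => - φ x) (-c)
  have h4 := lint_toENN_add_le Q (fun x => - φ x + ((-c : ℝ) : EReal)) (- -c)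
  have e (u : EReal) (c : ℝ) : u + c + ((-c : ℝ) : EReal) = u := by
    rw [EReal.coe_neg]; exact EReal.add_sub_cancel_right
  simp only [e] at h2 h4
  simp only [← neg_add_coe'] at h3 h4
  have h5 : ∫⁻ x, (φ x + c).toENN ∂Q + (∫⁻ x, (-(φ x)).toENN ∂Q + ENNReal.ofReal (-c)) =
      ∫⁻ x, (φ x).toENN ∂Q + (∫⁻ x, (-(φ x + c)).toENN ∂Q + ENNReal.ofReal c) := by
    have := lintegral_congr (μ := Q) fun x => toENN_shift (φ x) c
    have m1 : Measurable fun x => (φ x + c).toENN := toENN_measurable.comp (hc.comp hφ)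
    have m2 : Measurable fun x => (φ x).toENN := toENN_measurable.comp hφ
    rw [lintegral_add_left m1,
      lintegral_add_right _ measurable_const, lintegral_add_left m2,
      lintegral_add_right _ measurable_const] at this
    simpa using this
  unfold eint
  generalize ∫⁻ x, (φ x + c).toENN ∂Q = P' at *
  generalize ∫⁻ x, (φ x).toENN ∂Q = P at *
  generalize ∫⁻ x, (-(φ x)).toENN ∂Q = N at *
  generalize ∫⁻ x, (-(φ x + c)).toENN ∂Q = N' at *
  by_cases hN : N = ⊤
  · have hN' : N' = ⊤ := by
      subst hN
      by_contra h
      exact ENNReal.add_ne_top.2 ⟨h, ENNReal.ofReal_ne_top⟩ (top_le_iff.1 h4)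
    simp [hN, hN']
  have hN' : N' ≠ ⊤ := ne_top_of_le_ne_top (ENNReal.add_ne_top.2 ⟨hN, ENNReal.ofReal_ne_top⟩) h3
  by_cases hP : P = ⊤
  · have hP' : P' = ⊤ := by
      subst hP
      by_contra h
      exact ENNReal.add_ne_top.2 ⟨h, ENNReal.ofReal_ne_top⟩ (top_le_iff.1 h2)
    subst hP hP'
    rw [EReal.coe_ennreal_top, EReal.top_sub (by simpa using hN'), EReal.top_sub (by simpa using hN)]
    simp
  have hP' : P' ≠ ⊤ := ne_top_of_le_ne_top (ENNReal.add_ne_top.2 ⟨hP, ENNReal.ofReal_ne_top⟩) h1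
  lift N to NNReal using hN
  lift N' to NNReal using hN'
  lift P to NNReal using hP
  lift P' to NNReal using hP'
  have h6 : (P' : ℝ) + (N + max (-c) 0) = P + (N' + max c 0) := by
    have := congrArg ENNReal.toReal h5
    simpa [ENNReal.toReal_add, ENNReal.toReal_ofReal'] using this
  have h7 : max c 0 - max (-c) 0 = c := by
    rcases le_total 0 c with h | h
    · rw [max_eq_left h, max_eq_right (by linarith)]; ring
    · rw [max_eq_right h, max_eq_left (by linarith)]; ring
  have e2 (r : NNReal) : (((r : ℝ≥0∞)) : EReal) = ((r : ℝ) : EReal) := rfl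
  simp only [e2]
  rw [← EReal.coe_sub, ← EReal.coe_sub, ← EReal.coe_add]
  congr 1
  linarith

section
variable {E : Type*} [NormedAddCommGroup E] [NormedSpace ℝ E] [FiniteDimensional ℝ E]

/-- The affine homeomorphism `x ↦ a + B x`. -/
noncomputable def affHomeo (a : E) (B : E ≃ₗ[ℝ] E) : E ≃ₜ E :=
  B.toContinuousLinearEquiv.toHomeomorph.trans (Homeomorph.addLeft a)

theorem affHomeo_apply (a : E) (B : E ≃ₗ[ℝ] E) (x : E) : affHomeo a B x = a + B x := rfl

theorem isPhi_aff {φ : E → EReal} (hφ : IsPhi φ) (a : E) (B : E ≃ₗ[ℝ] E) (c : ℝ) :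
    IsPhi fun x => φ (a + B x) + c := by
  obtain ⟨h1, h2, h3, h4⟩ := hφ
  have hT : Continuous fun x => a + B x := (affHomeo a B).continuous
  have hcmon : Monotone fun u : EReal => u + (c : EReal) := fun u v h => by dsimp only; gcongr
  refine ⟨?_, ?_, ?_, ?_⟩
  · exact (eReal_continuous_add_coe c).comp_upperSemicontinuous (h1.comp hT) hcmon
  · intro x
    exact EReal.add_ne_top (h2 _) (EReal.coe_ne_top c)
  · intro x y s t hs ht hst
    have e : a + B (s • x + t • y) = s • (a + B x) + t • (a + B y) := by
      have : a = s • a + t • a := by rw [← add_smul, hst, one_smul]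
      nth_rewrite 1 [this]
      simp only [map_add, map_smul, smul_add]
      abel
    dsimp only
    rw [e]
    refine le_trans (le_of_eq ?_) (hcmon (h3 (a + B x) (a + B y) s t hs ht hst))
    dsimp only
    have hd (s : ℝ) (hs : 0 < s) (u : EReal) : (s : EReal) * (u + c) = s * u + ((s * c : ℝ) : EReal) := by
      rw [EReal.left_distrib_of_nonneg_of_ne_top (by exact_mod_cast hs.le) (EReal.coe_ne_top s),
        EReal.coe_mul]
    rw [hd s hs, hd t ht, add_add_add_comm, ← EReal.coe_add, ← add_mul, hst, one_mul]
  · have hprop : ProperSpace E := FiniteDimensional.proper ℝ E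
    rw [comap_norm_atTop, Metric.cobounded_eq_cocompact] at h4 ⊢
    have h5 := h4.comp (affHomeo a B).isClosedEmbedding.tendsto_cocompact
    have h6 := ((eReal_continuous_add_coe c).tendsto ⊥).comp h5
    rw [EReal.bot_add] at h6
    exact h6

variable [MeasureSpace E] [BorelSpace E] [(volume : Measure E).IsAddHaarMeasure]

theorem lfun_aff {φ : E → EReal} (hφ : IsPhi φ) (Q : Measure E) [IsProbabilityMeasure Q]
    (a : E) (B : E ≃ₗ[ℝ] E) :
    Lfun (fun x => φ (a + B x) + ((Real.log |LinearMap.det (B : E →ₗ[ℝ] E)| : ℝ) : EReal)) Q =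
      Lfun φ (Q.map fun x => a + B x) +
        ((Real.log |LinearMap.det (B : E →ₗ[ℝ] E)| : ℝ) : EReal) := by
  have hT : MeasurableEmbedding fun x => a + B x := (affHomeo a B).measurableEmbedding
  have hBm : MeasurableEmbedding (B : E →ₗ[ℝ] E) :=
    B.toContinuousLinearEquiv.toHomeomorph.measurableEmbedding
  have hdet : LinearMap.det (B : E →ₗ[ℝ] E) ≠ 0 := (LinearEquiv.isUnit_det' B).ne_zero
  have hφm : Measurable φ := hφ.1.measurable
  have h1 : eint (Q.map fun x => a + B x) φ = eint Q fun x => φ (a + B x) := by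
    unfold eint
    rw [hT.lintegral_map, hT.lintegral_map]
  have h2 : ∫⁻ x, EReal.exp (φ (a + B x) +
      ((Real.log |LinearMap.det (B : E →ₗ[ℝ] E)| : ℝ) : EReal)) = ∫⁻ x, EReal.exp (φ x) := by
    simp only [EReal.exp_add]
    rw [lintegral_mul_const' _ _ (by simp)]
    have h3 := Measure.map_linearMap_addHaar_eq_smul_addHaar (volume : Measure E) hdet
    have h4 : ∫⁻ x, EReal.exp (φ (a + B x)) =
        ENNReal.ofReal |(LinearMap.det (B : E →ₗ[ℝ] E))⁻¹| * ∫⁻ x, EReal.exp (φ x) := by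
      have h5 := hBm.lintegral_map (μ := volume) (fun y => EReal.exp (φ (a + y)))
      rw [h3, lintegral_smul_measure,
        lintegral_add_left_eq_self (fun y => EReal.exp (φ y)) a] at h5
      exact h5.symm
    rw [h4, EReal.exp_coe, Real.exp_log (abs_pos.2 hdet), mul_right_comm,
      ← ENNReal.ofReal_mul (abs_nonneg _), ← abs_mul, inv_mul_cancel₀ hdet]
    simp
  unfold Lfun
  rw [h2, eint_shift Q (fun x => φ (a + B x)) (hφm.comp hT.measurable), h1]
  simp only [sub_eq_add_neg]
  ac_rfl

end

/-- **Affine equivariance.** For `Q` with finite first moment and convex support with nonempty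
interior, a vector `a` and a nonsingular linear map `B`, the image measure `Q_{a,B}` of `Q`
under `x ↦ a + Bx` again has finite first moment and convex support with nonempty interior,
`L(Q_{a,B}) = L(Q) - log |det B|`, and the maximizer transforms as
`ψ(x | Q_{a,B}) = ψ(B⁻¹(x - a) | Q) - log |det B|`. -/
theorem Lprof_affine_equivariance {d : ℕ}
    (Q : Measure (EuclideanSpace ℝ (Fin d))) [IsProbabilityMeasure Q]
    (hmom : (∫⁻ x, (‖x‖₊ : ℝ≥0∞) ∂Q) ≠ ⊤) (hint : (interior (csupp Q)).Nonempty)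
    (a : EuclideanSpace ℝ (Fin d))
    (B : EuclideanSpace ℝ (Fin d) ≃ₗ[ℝ] EuclideanSpace ℝ (Fin d))
    (ψ : EuclideanSpace ℝ (Fin d) → EReal) (hψ : IsMLE Q ψ) :
    (∫⁻ x, (‖x‖₊ : ℝ≥0∞) ∂(Q.map fun x => a + B x)) ≠ ⊤ ∧
    (interior (csupp (Q.map fun x => a + B x))).Nonempty ∧
    Lprof (Q.map fun x => a + B x)
      = Lprof Q - ((Real.log |LinearMap.det (B : EuclideanSpace ℝ (Fin d) →ₗ[ℝ] EuclideanSpace ℝ (Fin d))| : ℝ) : EReal) ∧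
    IsMLE (Q.map fun x => a + B x)
      (fun x => ψ (B.symm (x - a))
        - ((Real.log |LinearMap.det (B : EuclideanSpace ℝ (Fin d) →ₗ[ℝ] EuclideanSpace ℝ (Fin d))| : ℝ) : EReal)) := by
  have hT : MeasurableEmbedding fun x => a + B x := (affHomeo a B).measurableEmbedding
  have hL := fun (φ : EuclideanSpace ℝ (Fin d) → EReal) (hφ : IsPhi φ) => lfun_aff hφ Q a B
  generalize hc : Real.log |LinearMap.det
    (B : EuclideanSpace ℝ (Fin d) →ₗ[ℝ] EuclideanSpace ℝ (Fin d))| = c at *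
  have hinv : ∀ φ : EuclideanSpace ℝ (Fin d) → EReal, IsPhi φ →
      IsPhi (fun x => φ (B.symm (x - a)) - (c : EReal)) := by
    intro φ hφ
    have h := isPhi_aff hφ (-(B.symm a)) B.symm (-c)
    convert h using 2 with x
    rw [map_sub, EReal.coe_neg, sub_eq_add_neg, sub_eq_add_neg, add_comm (B.symm x)]
  have hL' : ∀ φ : EuclideanSpace ℝ (Fin d) → EReal, IsPhi φ →
      Lfun (fun x => φ (B.symm (x - a)) - (c : EReal)) (Q.map fun x => a + B x)
        = Lfun φ Q - c := by
    intro φ hφ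
    have h := hL _ (hinv φ hφ)
    simp only [add_sub_cancel_left, LinearEquiv.symm_apply_apply, EReal.sub_add_cancel] at h
    rw [h, EReal.add_sub_cancel_right]
  have hLe : ∀ φ : EuclideanSpace ℝ (Fin d) → EReal, IsPhi φ →
      Lfun φ (Q.map fun x => a + B x) = Lfun (fun x => φ (a + B x) + c) Q - c := by
    intro φ hφ
    rw [hL φ hφ, EReal.add_sub_cancel_right]
  refine ⟨?_, ?_, ?_, hinv ψ hψ.1, ?_⟩
  · rw [hT.lintegral_map]
    set B' : EuclideanSpace ℝ (Fin d) →L[ℝ] EuclideanSpace ℝ (Fin d) :=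
      (B.toContinuousLinearEquiv : EuclideanSpace ℝ (Fin d) →L[ℝ] EuclideanSpace ℝ (Fin d))
    have hb : ∀ x, (‖a + B x‖₊ : ℝ≥0∞) ≤ ‖a‖₊ + ‖B'‖₊ * ‖x‖₊ := by
      intro x
      have h1 : ‖a + B x‖₊ ≤ ‖a‖₊ + ‖B'‖₊ * ‖x‖₊ :=
        (nnnorm_add_le _ _).trans (by gcongr; exact B'.le_opNNNorm x)
      exact_mod_cast h1
    refine ne_top_of_le_ne_top ?_ (lintegral_mono hb)
    rw [lintegral_add_left measurable_const, lintegral_const_mul' _ _ ENNReal.coe_ne_top]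
    simp only [lintegral_const, measure_univ, mul_one]
    exact ENNReal.add_ne_top.2 ⟨ENNReal.coe_ne_top, ENNReal.mul_ne_top ENNReal.coe_ne_top hmom⟩
  · have hsub : affHomeo a B '' interior (csupp Q) ⊆ csupp (Q.map fun x => a + B x) := by
      rintro _ ⟨x, hx, rfl⟩ C ⟨hC1, hC2, hC3⟩
      have hx' := interior_subset hx
      refine hx' ((fun x => a + B x) ⁻¹' C) ⟨hC1.preimage (affHomeo a B).continuous, ?_, ?_⟩
      · exact (hC2.translate_preimage_right a).linear_preimage
          (B : EuclideanSpace ℝ (Fin d) →ₗ[ℝ] EuclideanSpace ℝ (Fin d))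
      · rwa [hT.map_apply] at hC3
    exact (hint.image _).mono
      (interior_maximal hsub ((affHomeo a B).isOpenMap _ isOpen_interior))
  · unfold Lprof
    apply le_antisymm
    · refine iSup₂_le fun φ hφ => ?_
      rw [hLe φ hφ]
      exact EReal.sub_le_sub (le_iSup₂ (f := fun φ (_ : φ ∈ {φ | IsPhi φ}) => Lfun φ Q) _
        (isPhi_aff hφ a B c)) le_rfl
    · refine EReal.sub_le_of_le_add (iSup₂_le fun φ hφ => ?_)
      have h := le_iSup₂ (f := fun φ (_ : φ ∈ {φ | IsPhi φ}) =>
        Lfun φ (Q.map fun x => a + B x)) _ (hinv φ hφ)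
      rw [hL' φ hφ] at h
      rw [← EReal.sub_add_cancel (a := Lfun φ Q) (b := c)]
      gcongr
  · intro φ hφ
    rw [hLe φ hφ, hL' ψ hψ.1]
    exact EReal.sub_le_sub (hψ.2 _ (isPhi_aff hφ a B c)) le_rfl
end

section
/- The profile log-likelihood L is convex on the set Q^1(d) of probability distributions on ℝ^d with finite first moment: for arbitrary Q_0, Q_1 ∈ Q^1(d) and 0 < t < 1, L((1 − t)Q_0 + tQ_1) ≤ (1 − t)L(Q_0) + tL(Q_1). Moreover, the two sides are equal and real if and only if both Q_0 and Q_1 have convex support with nonempty interior and ψ(·|Q_0) = ψ(·|Q_1). -/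
open MeasureTheory Filter Topology Set
open scoped ENNReal RealInnerProductSpace BoundedContinuousFunction

theorem toENN_eq (x : EReal) : x.toENN = x.toENNReal := rfl

theorem toENNReal_split (K : ℝ) (hK : 0 ≤ K) (x : EReal) (hx : x ≤ (K : EReal)) :
    ((K : EReal) - x).toENNReal + x.toENNReal = ENNReal.ofReal K + (-x).toENNReal := by
  induction x with
  | bot => simp
  | top => simp at hx
  | coe y =>
    have hy : y ≤ K := by exact_mod_cast hx
    rw [← EReal.coe_sub, ← EReal.coe_neg]
    simp only [EReal.real_coe_toENNReal]
    rcases le_total 0 y with h | h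
    · rw [ENNReal.ofReal_of_nonpos (by linarith : -y ≤ 0), ← ENNReal.ofReal_add (by linarith) h]
      simp
    · rw [ENNReal.ofReal_of_nonpos h, ← ENNReal.ofReal_add hK (by linarith)]
      simp [sub_eq_add_neg]

section
variable {E : Type*} [MeasurableSpace E]

theorem eint_rep (Q : Measure E) [IsProbabilityMeasure Q] (φ : E → EReal) (hφ : Measurable φ)
    (K : ℝ) (hK : 0 ≤ K) (hb : ∀ x, φ x ≤ (K : EReal)) :
    eint Q φ = (K : EReal) - ((∫⁻ x, ((K : EReal) - φ x).toENNReal ∂Q : ℝ≥0∞) : EReal) := by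
  unfold eint
  simp only [toENN_eq]
  set P := ∫⁻ x, (φ x).toENNReal ∂Q with hP
  set N := ∫⁻ x, (-(φ x)).toENNReal ∂Q with hN
  set H := ∫⁻ x, ((K : EReal) - φ x).toENNReal ∂Q with hH
  have hsum : H + P = ENNReal.ofReal K + N := by
    rw [hH, hP, hN, ← lintegral_add_right _ hφ.ereal_toENNReal]
    have : ENNReal.ofReal K = ∫⁻ _, ENNReal.ofReal K ∂Q := by simp
    rw [this, ← lintegral_add_left measurable_const]
    exact lintegral_congr fun x => toENNReal_split K hK _ (hb x)
  have hPf : P ≠ ⊤ := by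
    have : P ≤ ∫⁻ _, ENNReal.ofReal K ∂Q := by
      refine lintegral_mono fun x => ?_
      rw [← EReal.real_coe_toENNReal]
      exact EReal.toENNReal_le_toENNReal (hb x)
    refine ne_top_of_le_ne_top ?_ this
    simp
  by_cases hNt : N = ⊤
  · have hHt : H = ⊤ := by
      rw [hNt] at hsum
      simp only [add_top, ENNReal.add_eq_top] at hsum
      exact hsum.resolve_right hPf
    rw [hNt, hHt]
    simp [EReal.sub_top]
  · have hHt : H ≠ ⊤ := by
      intro h
      rw [h] at hsum
      simp only [top_add] at hsum
      have := ENNReal.add_ne_top.2 ⟨ENNReal.ofReal_ne_top (r := K), hNt⟩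
      exact this hsum.symm
    clear_value P N H
    lift P to NNReal using hPf
    lift N to NNReal using hNt
    lift H to NNReal using hHt
    have h2 : (H : ℝ) + P = K + N := by
      have := congrArg ENNReal.toReal hsum
      rw [ENNReal.toReal_add (by simp) (by simp), ENNReal.toReal_add (by simp) (by simp),
        ENNReal.toReal_ofReal hK] at this
      simpa using this
    have e1 : (((P : NNReal) : ℝ≥0∞) : EReal) = ((P : ℝ) : EReal) := rfl
    have e2 : (((N : NNReal) : ℝ≥0∞) : EReal) = ((N : ℝ) : EReal) := rfl
    have e3 : (((H : NNReal) : ℝ≥0∞) : EReal) = ((H : ℝ) : EReal) := rfl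
    rw [e1, e2, e3, ← EReal.coe_sub, ← EReal.coe_sub]
    congr 1
    linarith
end

theorem IsPhi.measurable {E : Type*} [NormedAddCommGroup E] [NormedSpace ℝ E] [MeasurableSpace E]
    [BorelSpace E] {φ : E → EReal} (h : IsPhi φ) : Measurable φ := h.1.measurable

theorem Lfun_rep {E : Type*} [NormedAddCommGroup E] [NormedSpace ℝ E] [MeasureSpace E]
    [BorelSpace E] (Q : Measure E) [IsProbabilityMeasure Q] (φ : E → EReal) (hφ : Measurable φ)
    (K : ℝ) (hK : 0 ≤ K) (hb : ∀ x, φ x ≤ (K : EReal)) :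
    Lfun φ Q = ((K + 1 : ℝ) : EReal) - ((∫⁻ x, ((K : EReal) - φ x).toENNReal ∂Q
      + ∫⁻ x, EReal.exp (φ x) : ℝ≥0∞) : EReal) := by
  unfold Lfun
  rw [eint_rep Q φ hφ K hK hb]
  generalize ∫⁻ x, ((K : EReal) - φ x).toENNReal ∂Q = H
  generalize (∫⁻ x, EReal.exp (φ x) : ℝ≥0∞) = I
  rw [EReal.coe_ennreal_add]
  by_cases hH : H = ⊤
  · simp [hH, EReal.sub_top]
  by_cases hI : I = ⊤
  · simp [hI, EReal.sub_top]
  lift H to NNReal using hH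
  lift I to NNReal using hI
  have e1 : (((H : NNReal) : ℝ≥0∞) : EReal) = ((H : ℝ) : EReal) := rfl
  have e2 : (((I : NNReal) : ℝ≥0∞) : EReal) = ((I : ℝ) : EReal) := rfl
  rw [e1, e2]
  have : (1 : EReal) = ((1 : ℝ) : EReal) := rfl
  rw [this]
  norm_cast
  push_cast
  ring_nf

/-- Real form of concavity. -/
theorem conc_real {E : Type*} [NormedAddCommGroup E] [NormedSpace ℝ E] {φ : E → EReal}
    (h : IsPhi φ) {x y : E} {a b s t : ℝ} (ha : 0 < a) (hb : 0 < b) (hab : a + b = 1)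
    (hs : (s : EReal) ≤ φ x) (ht : (t : EReal) ≤ φ y) :
    ((a * s + b * t : ℝ) : EReal) ≤ φ (a • x + b • y) := by
  refine le_trans ?_ (h.2.2.1 x y a b ha hb hab)
  rw [EReal.coe_add, EReal.coe_mul, EReal.coe_mul]
  have ha' : (0 : EReal) ≤ (a : EReal) := by exact_mod_cast ha.le
  have hb' : (0 : EReal) ≤ (b : EReal) := by exact_mod_cast hb.le
  exact add_le_add (mul_le_mul_of_nonneg_left hs ha') (mul_le_mul_of_nonneg_left ht hb')

theorem conc_of_real {E : Type*} [NormedAddCommGroup E] [NormedSpace ℝ E] {φ : E → EReal}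
    (htop : ∀ x, φ x ≠ ⊤)
    (h : ∀ x y : E, ∀ a b s t : ℝ, 0 < a → 0 < b → a + b = 1 → (s : EReal) ≤ φ x →
      (t : EReal) ≤ φ y → ((a * s + b * t : ℝ) : EReal) ≤ φ (a • x + b • y)) :
    ∀ x y : E, ∀ a b : ℝ, 0 < a → 0 < b → a + b = 1 →
      (a : EReal) * φ x + (b : EReal) * φ y ≤ φ (a • x + b • y) := by
  intro x y a b ha hb hab
  by_cases hx : φ x = ⊥
  · rw [hx, EReal.coe_mul_bot_of_pos ha]; simp
  by_cases hy : φ y = ⊥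
  · rw [hy, EReal.coe_mul_bot_of_pos hb]; simp
  have := h x y a b (φ x).toReal (φ y).toReal ha hb hab
    (by rw [EReal.coe_toReal (htop x) hx]) (by rw [EReal.coe_toReal (htop y) hy])
  rwa [EReal.coe_add, EReal.coe_mul, EReal.coe_mul, EReal.coe_toReal (htop x) hx,
    EReal.coe_toReal (htop y) hy] at this

theorem level_convex {E : Type*} [NormedAddCommGroup E] [NormedSpace ℝ E] {φ : E → EReal}
    (h : IsPhi φ) (s : ℝ) : Convex ℝ {x | (s : EReal) ≤ φ x} := by
  rw [convex_iff_forall_pos]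
  intro x hx y hy a b ha hb hab
  have := conc_real h ha hb hab hx hy
  have e : a * s + b * s = s := by rw [← add_mul, hab, one_mul]
  rw [e] at this
  exact this

theorem level_closed {E : Type*} [NormedAddCommGroup E] [NormedSpace ℝ E] {φ : E → EReal}
    (h : IsPhi φ) (s : ℝ) : IsClosed {x | (s : EReal) ≤ φ x} :=
  h.1.isClosed_preimage _

/-- The maximum is attained. -/
theorem exists_max {E : Type*} [NormedAddCommGroup E] [NormedSpace ℝ E] [FiniteDimensional ℝ E]
    {φ : E → EReal} (h : IsPhi φ) : ∃ m, ∀ x, φ x ≤ φ m := by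
  have := FiniteDimensional.proper_real E
  by_cases hall : ∀ x, φ x = ⊥
  · exact ⟨0, fun x => by rw [hall x]; exact bot_le⟩
  push Not at hall
  obtain ⟨p, hp⟩ := hall
  have hev : ∀ᶠ x in Filter.comap (fun x : E => ‖x‖) atTop, φ x < φ p :=
    h.2.2.2.eventually (gt_mem_nhds (bot_lt_iff_ne_bot.2 hp))
  rw [eventually_comap] at hev
  obtain ⟨R, hR⟩ := eventually_atTop.1 hev
  obtain ⟨m, hm, hmax⟩ := UpperSemicontinuousOn.exists_isMaxOn (s := Metric.closedBall (0 : E) (max R ‖p‖))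
    ⟨p, by simp⟩ (isCompact_closedBall _ _) (h.1.upperSemicontinuousOn _)
  refine ⟨m, fun x => ?_⟩
  by_cases hx : ‖x‖ ≤ max R ‖p‖
  · exact hmax (by simpa using hx)
  · push Not at hx
    have h1 : φ x < φ p := hR ‖x‖ ((le_max_left _ _).trans hx.le) x rfl
    exact h1.le.trans (hmax (by simp))

theorem exists_bound {E : Type*} [NormedAddCommGroup E] [NormedSpace ℝ E] [FiniteDimensional ℝ E]
    {φ : E → EReal} (h : IsPhi φ) : ∃ K : ℝ, 0 ≤ K ∧ ∀ x, φ x ≤ (K : EReal) := by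
  obtain ⟨m, hm⟩ := exists_max h
  by_cases hb : φ m = ⊥
  · exact ⟨0, le_rfl, fun x => (hm x).trans (by rw [hb]; exact bot_le)⟩
  · refine ⟨max 0 (φ m).toReal, le_max_left _ _, fun x => (hm x).trans ?_⟩
    rw [← EReal.coe_toReal (h.2.1 m) hb]
    exact_mod_cast le_max_right _ _


theorem mix_prob {E : Type*} [MeasurableSpace E] (Q₀ Q₁ : Measure E)
    [IsProbabilityMeasure Q₀] [IsProbabilityMeasure Q₁]
    (t : ℝ) (ht₀ : 0 < t) (ht₁ : t < 1) :
    IsProbabilityMeasure (ENNReal.ofReal (1 - t) • Q₀ + ENNReal.ofReal t • Q₁) := by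
  constructor
  simp only [Measure.coe_add, Measure.coe_smul, Pi.add_apply, Pi.smul_apply, measure_univ,
    smul_eq_mul, mul_one]
  rw [← ENNReal.ofReal_add (by linarith) ht₀.le]
  simp

theorem Lfun_mix {E : Type*} [NormedAddCommGroup E] [NormedSpace ℝ E] [FiniteDimensional ℝ E]
    [MeasureSpace E] [BorelSpace E] (Q₀ Q₁ : Measure E)
    [IsProbabilityMeasure Q₀] [IsProbabilityMeasure Q₁]
    (t : ℝ) (ht₀ : 0 < t) (ht₁ : t < 1) {φ : E → EReal} (h : IsPhi φ) :
    Lfun φ (ENNReal.ofReal (1 - t) • Q₀ + ENNReal.ofReal t • Q₁)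
      = ((1 - t : ℝ) : EReal) * Lfun φ Q₀ + (t : EReal) * Lfun φ Q₁ := by
  have := mix_prob Q₀ Q₁ t ht₀ ht₁
  obtain ⟨K, hK, hb⟩ := exists_bound h
  have ht1 : 0 < 1 - t := by linarith
  rw [Lfun_rep _ φ h.measurable K hK hb, Lfun_rep _ φ h.measurable K hK hb,
    Lfun_rep _ φ h.measurable K hK hb, lintegral_add_measure, lintegral_smul_measure,
    lintegral_smul_measure]
  generalize ∫⁻ x, ((K : EReal) - φ x).toENNReal ∂Q₀ = H₀
  generalize ∫⁻ x, ((K : EReal) - φ x).toENNReal ∂Q₁ = H₁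
  generalize (∫⁻ x, EReal.exp (φ x) : ℝ≥0∞) = I
  have hbot : ∀ r : ℝ, (r : EReal) - ((⊤ : ℝ≥0∞) : EReal) = ⊥ := by intro r; simp [EReal.sub_top]
  by_cases hI : I = ⊤
  · rw [hI]
    simp only [add_top, hbot]
    rw [EReal.coe_mul_bot_of_pos ht1]
    simp
  by_cases hH₀ : H₀ = ⊤
  · rw [hH₀]
    have : ENNReal.ofReal (1 - t) • (⊤ : ℝ≥0∞) = ⊤ := by
      rw [smul_eq_mul, ENNReal.mul_top (by simpa using ht₁)]
    rw [this]
    simp only [top_add, hbot]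
    rw [EReal.coe_mul_bot_of_pos ht1]
    simp
  by_cases hH₁ : H₁ = ⊤
  · rw [hH₁]
    have : ENNReal.ofReal t • (⊤ : ℝ≥0∞) = ⊤ := by
      rw [smul_eq_mul, ENNReal.mul_top (by simpa using ht₀)]
    rw [this]
    simp only [add_top, top_add, hbot]
    rw [EReal.coe_mul_bot_of_pos ht₀]
    simp
  lift H₀ to NNReal using hH₀
  lift H₁ to NNReal using hH₁
  lift I to NNReal using hI
  have e : ∀ a : NNReal, ((a : ℝ≥0∞) : EReal) = ((a : ℝ) : EReal) := fun _ => rfl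
  have e0 : ENNReal.ofReal (1 - t) = ((Real.toNNReal (1 - t) : NNReal) : ℝ≥0∞) := rfl
  have e1 : ENNReal.ofReal t = ((Real.toNNReal t : NNReal) : ℝ≥0∞) := rfl
  rw [e0, e1, smul_eq_mul, smul_eq_mul, ← ENNReal.coe_mul, ← ENNReal.coe_mul, ← ENNReal.coe_add,
    ← ENNReal.coe_add, ← ENNReal.coe_add, ← ENNReal.coe_add, e, e, e, ← EReal.coe_sub,
    ← EReal.coe_sub, ← EReal.coe_sub, ← EReal.coe_mul, ← EReal.coe_mul, ← EReal.coe_add]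
  congr 1
  push_cast
  rw [Real.coe_toNNReal _ ht1.le, Real.coe_toNNReal _ ht₀.le]
  ring

open Classical in
/-- Test function: `c - ‖x‖` on the set `C`, `-∞` elsewhere. -/
noncomputable def testFun {E : Type*} [NormedAddCommGroup E] (C : Set E) (c : ℝ) (x : E) : EReal :=
  if x ∈ C then ((c - ‖x‖ : ℝ) : EReal) else ⊥

theorem testFun_le {E : Type*} [NormedAddCommGroup E] (C : Set E) (c : ℝ) (x : E) :
    testFun C c x ≤ ((c - ‖x‖ : ℝ) : EReal) := by
  unfold testFun; split_ifs
  · exact le_rfl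
  · exact bot_le

theorem testFun_isPhi {E : Type*} [NormedAddCommGroup E] [NormedSpace ℝ E] (C : Set E)
    (hc : IsClosed C) (hC : Convex ℝ C) (c : ℝ) : IsPhi (testFun C c) := by
  have htop : ∀ x, testFun C c x ≠ ⊤ := fun x h => by
    have := testFun_le C c x
    rw [h, top_le_iff] at this
    exact EReal.coe_ne_top _ this
  have hmem : ∀ (x : E) (s : ℝ), (s : EReal) ≤ testFun C c x ↔ x ∈ C ∧ s ≤ c - ‖x‖ := by
    intro x s
    unfold testFun
    split_ifs with h
    · rw [EReal.coe_le_coe_iff]; tauto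
    · simp [h]
  refine ⟨?_, htop, ?_, ?_⟩
  · intro x y hy
    by_cases hx : x ∈ C
    · have hcont : ContinuousAt (fun x : E => ((c - ‖x‖ : ℝ) : EReal)) x := by
        refine continuous_coe_real_ereal.continuousAt.comp ?_
        fun_prop
      have hx' : testFun C c x = ((c - ‖x‖ : ℝ) : EReal) := by simp [testFun, hx]
      rw [hx'] at hy
      filter_upwards [hcont.eventually (gt_mem_nhds hy)] with z hz
      exact (testFun_le C c z).trans_lt hz
    · filter_upwards [hc.isOpen_compl.mem_nhds hx] with z hz
      have : testFun C c z = ⊥ := by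
        have hz' : z ∉ C := hz
        simp [testFun, hz']
      rw [this]
      exact bot_le.trans_lt hy
  · refine conc_of_real htop ?_
    intro x y a b s t ha hb hab hs ht
    rw [hmem] at hs ht ⊢
    refine ⟨hC hs.1 ht.1 ha.le hb.le hab, ?_⟩
    have h1 : ‖a • x + b • y‖ ≤ a * ‖x‖ + b * ‖y‖ := by
      refine (norm_add_le _ _).trans ?_
      rw [norm_smul, norm_smul, Real.norm_of_nonneg ha.le, Real.norm_of_nonneg hb.le]
    have h2 := mul_le_mul_of_nonneg_left hs.2 ha.le
    have h3 := mul_le_mul_of_nonneg_left ht.2 hb.le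
    have h4 : c = a * c + b * c := by rw [← add_mul, hab, one_mul]
    nlinarith
  · rw [EReal.tendsto_nhds_bot_iff_real]
    intro r
    rw [eventually_comap]
    filter_upwards [eventually_gt_atTop (c - r)] with n hn x hx
    refine (testFun_le C c x).trans_lt ?_
    rw [EReal.coe_lt_coe_iff]
    have : ‖x‖ = n := hx
    linarith

theorem Lfun_test {E : Type*} [NormedAddCommGroup E] [NormedSpace ℝ E] [MeasureSpace E]
    [BorelSpace E] (Q : Measure E) [IsProbabilityMeasure Q] (C : Set E)
    (hc : IsClosed C) (hC : Convex ℝ C) (hQ : Q C = 1) (c : ℝ) (hc0 : 0 ≤ c) :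
    Lfun (testFun C c) Q = ((c + 1 : ℝ) : EReal) - ((∫⁻ x, (‖x‖₊ : ℝ≥0∞) ∂Q
      + ∫⁻ x, EReal.exp (testFun C c x) : ℝ≥0∞) : EReal) := by
  rw [Lfun_rep Q _ (testFun_isPhi C hc hC c).measurable c hc0]
  · congr 3
    refine lintegral_congr_ae ?_
    have hae : ∀ᵐ x ∂Q, x ∈ C := by
      change C ∈ ae Q
      rw [mem_ae_iff, prob_compl_eq_zero_iff hc.measurableSet]; exact hQ
    filter_upwards [hae] with x hx
    simp only [testFun, hx, if_true]
    rw [← EReal.coe_sub, EReal.real_coe_toENNReal]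
    simp only [sub_sub_cancel]
    exact ofReal_norm x
  · intro x
    refine (testFun_le C c x).trans ?_
    rw [EReal.coe_le_coe_iff]
    have := norm_nonneg x
    linarith

theorem csupp_full {E : Type*} [NormedAddCommGroup E] [NormedSpace ℝ E] [MeasurableSpace E]
    [BorelSpace E] [SecondCountableTopology E] (Q : Measure E) [IsProbabilityMeasure Q] :
    Q (csupp Q) = 1 := by
  have hcl : IsClosed (csupp Q) := isClosed_sInter fun C hC => hC.1
  rw [← prob_compl_eq_zero_iff hcl.measurableSet, csupp, compl_sInter]
  obtain ⟨T, hT, hsub, heq⟩ := TopologicalSpace.isOpen_sUnion_countable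
    (compl '' {C : Set E | IsClosed C ∧ Convex ℝ C ∧ Q C = 1}) (by
      rintro _ ⟨C, hC, rfl⟩
      exact hC.1.isOpen_compl)
  rw [← heq, measure_sUnion_null_iff hT]
  intro s hs
  obtain ⟨C, hC, rfl⟩ := hsub hs
  rw [prob_compl_eq_zero_iff hC.1.measurableSet]
  exact hC.2.2

theorem Lfun_le_Lprof {E : Type*} [NormedAddCommGroup E] [NormedSpace ℝ E] [MeasureSpace E]
    {φ : E → EReal} (h : IsPhi φ) (Q : Measure E) : Lfun φ Q ≤ Lprof Q :=
  le_iSup₂ (f := fun φ (_ : φ ∈ {φ : E → EReal | IsPhi φ}) => Lfun φ Q) φ h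

theorem csupp_interior {E : Type*} [NormedAddCommGroup E] [NormedSpace ℝ E]
    [FiniteDimensional ℝ E] [MeasureSpace E]
    [BorelSpace E] [(volume : Measure E).IsAddHaarMeasure] (Q : Measure E) [IsProbabilityMeasure Q]
    (hm : (∫⁻ x, (‖x‖₊ : ℝ≥0∞) ∂Q) ≠ ⊤) (hL : Lprof Q ≠ ⊤) :
    (interior (csupp Q)).Nonempty := by
  have := FiniteDimensional.proper_real E
  by_contra hne
  rw [not_nonempty_iff_eq_empty] at hne
  have hcl : IsClosed (csupp Q) := isClosed_sInter fun C hC => hC.1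
  have hcv : Convex ℝ (csupp Q) := convex_sInter fun C hC => hC.2.1
  have hnull : (volume : Measure E) (csupp Q) = 0 := by
    have := hcv.addHaar_frontier (μ := volume)
    rwa [hcl.frontier_eq, hne, sdiff_empty] at this
  apply hL
  rw [EReal.eq_top_iff_forall_lt]
  intro y
  lift (∫⁻ x, (‖x‖₊ : ℝ≥0∞) ∂Q) to NNReal using hm with m hmm
  have h1 := Lfun_test Q (csupp Q) hcl hcv (csupp_full Q) (max 0 (y + m)) (le_max_left _ _)
  have h2 : (∫⁻ x, EReal.exp (testFun (csupp Q) (max 0 (y + m)) x) : ℝ≥0∞) = 0 := by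
    rw [← lintegral_zero (μ := (volume : Measure E))]
    refine lintegral_congr_ae ?_
    filter_upwards [measure_eq_zero_iff_ae_notMem.1 hnull] with x hx
    simp [testFun, hx]
  rw [h2, ← hmm, add_zero] at h1
  refine lt_of_lt_of_le ?_ (Lfun_le_Lprof (testFun_isPhi (csupp Q) hcl hcv (max 0 (y + m))) Q)
  rw [h1]
  have e : ((m : ℝ≥0∞) : EReal) = ((m : ℝ) : EReal) := rfl
  rw [e, ← EReal.coe_sub, EReal.coe_lt_coe_iff]
  have := le_max_right 0 (y + m)
  linarith

theorem lintegral_exp_neg_norm {E : Type*} [NormedAddCommGroup E] [NormedSpace ℝ E]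
    [FiniteDimensional ℝ E] [MeasureSpace E]
    [BorelSpace E] [(volume : Measure E).IsAddHaarMeasure] :
    (∫⁻ x : E, ENNReal.ofReal (Real.exp (-‖x‖))) ≠ ⊤ := by
  set n := Module.finrank ℝ E + 1 with hn
  have h := finite_integral_one_add_norm (E := E) (μ := volume) (r := (n : ℝ)) (by simp [hn])
  have hle : ∀ x : E, ENNReal.ofReal (Real.exp (-‖x‖)) ≤
      ENNReal.ofReal (n.factorial * Real.exp 1) * ENNReal.ofReal ((1 + ‖x‖) ^ (-(n : ℝ))) := by
    intro x
    rw [← ENNReal.ofReal_mul (by positivity)]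
    apply ENNReal.ofReal_le_ofReal
    have h0 : 0 ≤ ‖x‖ := norm_nonneg x
    have h1 := Real.pow_div_factorial_le_exp (1 + ‖x‖) (by linarith) n
    rw [Real.rpow_neg (by linarith), Real.rpow_natCast]
    have h2 : Real.exp (1 + ‖x‖) = Real.exp 1 * Real.exp ‖x‖ := Real.exp_add _ _
    rw [Real.exp_neg, ← div_eq_mul_inv, inv_eq_one_div,
      div_le_div_iff₀ (Real.exp_pos _) (by positivity), one_mul, mul_assoc, ← h2]
    rw [div_le_iff₀ (by positivity)] at h1
    linarith
  refine ne_top_of_le_ne_top ?_ (lintegral_mono hle)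
  rw [lintegral_const_mul' _ _ ENNReal.ofReal_ne_top]
  exact ENNReal.mul_ne_top ENNReal.ofReal_ne_top h.ne

theorem Lprof_ne_bot {E : Type*} [NormedAddCommGroup E] [NormedSpace ℝ E]
    [FiniteDimensional ℝ E] [MeasureSpace E]
    [BorelSpace E] [(volume : Measure E).IsAddHaarMeasure] (Q : Measure E) [IsProbabilityMeasure Q]
    (hm : (∫⁻ x, (‖x‖₊ : ℝ≥0∞) ∂Q) ≠ ⊤) : Lprof Q ≠ ⊥ := by
  have h1 := Lfun_test Q univ isClosed_univ convex_univ (by simp) 0 le_rfl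
  have h2 := Lfun_le_Lprof (testFun_isPhi (univ : Set E) isClosed_univ convex_univ 0) Q
  have h3 : (∫⁻ x : E, EReal.exp (testFun univ 0 x) : ℝ≥0∞) ≠ ⊤ := by
    have : ∀ x : E, EReal.exp (testFun univ 0 x) = ENNReal.ofReal (Real.exp (-‖x‖)) := by
      intro x
      simp only [testFun, mem_univ, if_true, EReal.exp_coe, zero_sub]
    simp only [this]
    exact lintegral_exp_neg_norm
  rw [h1] at h2
  have h4 := ENNReal.add_ne_top.2 ⟨hm, h3⟩
  lift (∫⁻ x, (‖x‖₊ : ℝ≥0∞) ∂Q + ∫⁻ x : E, EReal.exp (testFun univ 0 x)) to NNReal using h4 with m hmm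
  intro hb
  rw [hb, le_bot_iff] at h2
  have e : ((m : ℝ≥0∞) : EReal) = ((m : ℝ) : EReal) := rfl
  rw [e, ← EReal.coe_sub] at h2
  exact EReal.coe_ne_bot _ h2

theorem Lfun_ne_top {E : Type*} [NormedAddCommGroup E] [NormedSpace ℝ E]
    [FiniteDimensional ℝ E] [MeasureSpace E] [BorelSpace E]
    (Q : Measure E) [IsProbabilityMeasure Q] {φ : E → EReal} (h : IsPhi φ) : Lfun φ Q ≠ ⊤ := by
  obtain ⟨K, hK, hb⟩ := exists_bound h
  rw [Lfun_rep Q φ h.measurable K hK hb]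
  generalize (∫⁻ x, ((K : EReal) - φ x).toENNReal ∂Q + ∫⁻ x, EReal.exp (φ x) : ℝ≥0∞) = I
  intro hh
  have : ((K + 1 : ℝ) : EReal) - (I : EReal) ≤ ((K + 1 : ℝ) : EReal) := by
    rw [sub_eq_add_neg]
    have h0 : -(I : EReal) ≤ 0 := by
      rw [EReal.neg_le_zero]; exact EReal.coe_ennreal_nonneg I
    calc _ ≤ ((K + 1 : ℝ) : EReal) + 0 := add_le_add le_rfl h0
      _ = _ := add_zero _
  rw [hh] at this
  simp only [top_le_iff] at this
  exact EReal.coe_ne_top _ this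


/-- Uniform mass gap for convex sets that do not contain a given ball. -/
def BallGap {E : Type*} [NormedAddCommGroup E] [NormedSpace ℝ E] [MeasurableSpace E]
    (Q : Measure E) (x₀ : E) (r δ : ℝ) : Prop :=
  ∀ C : Set E, IsClosed C → Convex ℝ C → ¬ Metric.closedBall x₀ r ⊆ C → ENNReal.ofReal δ ≤ Q Cᶜ

theorem exists_ballGap {E : Type*} [NormedAddCommGroup E] [NormedSpace ℝ E]
    [FiniteDimensional ℝ E] [MeasurableSpace E] [BorelSpace E]
    (Q : Measure E) [IsProbabilityMeasure Q] (hint : (interior (csupp Q)).Nonempty) :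
    ∃ x₀ r δ, 0 < r ∧ 0 < δ ∧ δ ≤ 1 ∧ BallGap Q x₀ r δ := by
  have := FiniteDimensional.proper_real E
  have := FiniteDimensional.proper_real (E →L[ℝ] ℝ)
  obtain ⟨x₀, hx₀⟩ := hint
  obtain ⟨ε, hε, hball⟩ := Metric.isOpen_iff.1 isOpen_interior x₀ hx₀
  refine ⟨x₀, ε / 2, ?_⟩
  by_contra hcon
  have key : ∀ n : ℕ, ∃ p : E × (E →L[ℝ] ℝ), p.1 ∈ Metric.closedBall x₀ (ε / 2) ∧
      p.2 ∈ Metric.sphere (0 : E →L[ℝ] ℝ) 1 ∧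
      Q {x | p.2 p.1 < p.2 x} ≤ ENNReal.ofReal (1 / ((n : ℝ) + 1)) := by
    intro n
    have hn : ¬ BallGap Q x₀ (ε / 2) (1 / ((n : ℝ) + 1)) := by
      intro hg
      refine hcon ⟨1 / ((n : ℝ) + 1), by positivity, by positivity, ?_, hg⟩
      rw [div_le_one (by positivity)]
      have : (0 : ℝ) ≤ n := by positivity
      linarith
    unfold BallGap at hn
    push Not at hn
    obtain ⟨C, hc, hC, hsub, hQ⟩ := hn
    obtain ⟨b, hb, hbC⟩ := not_subset.1 hsub
    have hCne : C.Nonempty := by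
      rw [nonempty_iff_ne_empty]
      rintro rfl
      simp only [compl_empty, measure_univ] at hQ
      have h1 : ENNReal.ofReal (1 / ((n : ℝ) + 1)) ≤ 1 := by
        rw [ENNReal.ofReal_le_one, div_le_one (by positivity)]
        have : (0 : ℝ) ≤ n := by positivity
        linarith
      exact absurd hQ (not_lt.2 h1)
    obtain ⟨f, u, hfu, hub⟩ := geometric_hahn_banach_closed_point hC hc hbC
    obtain ⟨a, ha⟩ := hCne
    have hf0 : f ≠ 0 := by
      rintro rfl
      have := (hfu a ha).trans hub
      simp at this
    have hfn : 0 < ‖f‖ := norm_pos_iff.2 hf0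
    refine ⟨(b, ‖f‖⁻¹ • f), hb, ?_, ?_⟩
    · simp [norm_smul, hfn.ne']
    · refine (measure_mono ?_).trans hQ.le
      intro x hx hxC
      have hx' : ‖f‖⁻¹ * f b < ‖f‖⁻¹ * f x := hx
      have := lt_of_mul_lt_mul_left hx' (by positivity)
      have h2 := hfu x hxC
      linarith
  choose p hp1 hp2 hp3 using key
  obtain ⟨q, hq, σ, hσ, hlim⟩ := ((isCompact_closedBall x₀ (ε / 2)).prod
    (isCompact_sphere (0 : E →L[ℝ] ℝ) 1)).tendsto_subseq (x := p) (fun n => ⟨hp1 n, hp2 n⟩)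
  have hcont : ∀ x : E, Tendsto (fun n => (p (σ n)).2 x - (p (σ n)).2 (p (σ n)).1) atTop
      (𝓝 (q.2 x - q.2 q.1)) := by
    intro x
    have hc : Continuous (fun p : E × (E →L[ℝ] ℝ) => p.2 x - p.2 p.1) := by fun_prop
    exact (hc.tendsto q).comp hlim
  have hmeas : ∀ p : E × (E →L[ℝ] ℝ), MeasurableSet {x | p.2 p.1 < p.2 x} := fun p =>
    (isOpen_lt continuous_const p.2.continuous).measurableSet
  have hzero : Q {x | q.2 q.1 < q.2 x} = 0 := by
    have h1 : Q {x | q.2 q.1 < q.2 x} ≤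
        liminf (fun n => Q {x | (p (σ n)).2 (p (σ n)).1 < (p (σ n)).2 x}) atTop := by
      rw [← lintegral_indicator_one (hmeas q)]
      simp_rw [← lintegral_indicator_one (hmeas _)]
      refine le_trans (lintegral_mono ?_) (lintegral_liminf_le
        (fun n => measurable_one.indicator (hmeas _)))
      intro x
      by_cases hx : q.2 q.1 < q.2 x
      · have hev : ∀ᶠ n in atTop, 0 < (p (σ n)).2 x - (p (σ n)).2 (p (σ n)).1 :=
          (hcont x).eventually (lt_mem_nhds (by linarith))
        refine le_liminf_of_le (by isBoundedDefault) ?_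
        filter_upwards [hev] with n hn
        have h2 : x ∈ {x | (p (σ n)).2 (p (σ n)).1 < (p (σ n)).2 x} := by
          simp only [mem_ofPred_eq]; linarith
        rw [indicator_of_mem h2]
        exact indicator_le_self' (by simp) x
      · have h2 : x ∉ {x | q.2 q.1 < q.2 x} := hx
        simp only [indicator_of_notMem h2, zero_le]
    have h2 : Tendsto (fun n => ENNReal.ofReal (1 / ((σ n : ℝ) + 1))) atTop (𝓝 0) := by
      have h3 : Tendsto (fun n : ℕ => (1 : ℝ) / ((n : ℝ) + 1)) atTop (𝓝 0) :=
        tendsto_one_div_add_atTop_nhds_zero_nat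
      have h4 := (ENNReal.tendsto_ofReal h3).comp hσ.tendsto_atTop
      rw [ENNReal.ofReal_zero] at h4
      exact h4
    have h3 := liminf_le_liminf (f := atTop) (Eventually.of_forall fun n => hp3 (σ n))
      (by isBoundedDefault) (by isBoundedDefault)
    rw [h2.liminf_eq] at h3
    exact le_antisymm (h1.trans h3) (zero_le)
  have hfull : Q {x | q.2 x ≤ q.2 q.1} = 1 := by
    have hm : MeasurableSet {x | q.2 x ≤ q.2 q.1} :=
      (isClosed_le q.2.continuous continuous_const).measurableSet
    rw [← prob_compl_eq_zero_iff hm]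
    convert hzero using 2
    ext x; simp
  have hsub : csupp Q ⊆ {x | q.2 x ≤ q.2 q.1} := by
    refine sInter_subset_of_mem ⟨isClosed_le q.2.continuous continuous_const, ?_, hfull⟩
    exact convex_halfSpace_le q.2.toLinearMap.isLinear _
  have hqn : ‖q.2‖ = 1 := by simpa using hq.2
  have hq0 : q.2 ≠ 0 := by
    intro h; rw [h] at hqn; simp at hqn
  obtain ⟨v, hv⟩ : ∃ v, 0 < q.2 v := by
    by_contra hno
    push Not at hno
    apply hq0
    ext v
    have h1 := hno v
    have h2 := hno (-v)
    rw [map_neg] at h2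
    simp only [zero_apply]
    linarith
  have hmemq : q.1 ∈ interior (csupp Q) := by
    apply hball
    have := hq.1
    simp only [Metric.mem_closedBall, Metric.mem_ball] at this ⊢
    linarith
  have hev : ∀ᶠ s : ℝ in 𝓝 0, q.1 + s • v ∈ interior (csupp Q) := by
    have hc : Continuous (fun s : ℝ => q.1 + s • v) := by fun_prop
    have := hc.tendsto 0
    simp only [zero_smul, add_zero] at this
    exact this (isOpen_interior.mem_nhds hmemq)
  have hev2 : ∀ᶠ s : ℝ in 𝓝[>] 0, q.1 + s • v ∈ interior (csupp Q) := hev.filter_mono nhdsWithin_le_nhds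
  obtain ⟨s, hs, hs0⟩ := (hev2.and self_mem_nhdsWithin).exists
  have h5 := hsub (interior_subset hs)
  simp only [mem_ofPred_eq, map_add, map_smul, smul_eq_mul] at h5
  have : 0 < s * q.2 v := mul_pos hs0 hv
  linarith

theorem J_bound {a K : ℝ} {J : ℝ≥0∞} (h : (a : EReal) ≤ (K : EReal) - (J : EReal)) :
    J ≤ ENNReal.ofReal (K - a) ∧ 0 ≤ K - a := by
  by_cases hJ : J = ⊤
  · rw [hJ] at h
    simp [EReal.sub_top] at h
  lift J to NNReal using hJ
  have e : ((J : ℝ≥0∞) : EReal) = ((J : ℝ) : EReal) := rfl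
  rw [e, ← EReal.coe_sub, EReal.coe_le_coe_iff] at h
  have hJ0 : (0 : ℝ) ≤ J := J.2
  refine ⟨?_, by linarith⟩
  rw [← ENNReal.ofReal_coe_nnreal]
  exact ENNReal.ofReal_le_ofReal (by linarith)

theorem gap_H {E : Type*} [NormedAddCommGroup E] [NormedSpace ℝ E]
    [MeasurableSpace E] [BorelSpace E] (Q : Measure E) {x₀ : E} {r δ : ℝ}
    (hg : BallGap Q x₀ r δ) {φ : E → EReal} (h : IsPhi φ) (K s : ℝ) (hsK : s ≤ K) {b : E}
    (hb : b ∈ Metric.closedBall x₀ r) (hs : φ b < (s : EReal)) :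
    ENNReal.ofReal ((K - s) * δ) ≤ ∫⁻ x, ((K : EReal) - φ x).toENNReal ∂Q := by
  have h1 := hg {x | (s : EReal) ≤ φ x} (level_closed h s) (level_convex h s)
    (fun hsub => absurd (hsub hb) (not_le.2 hs))
  have hms : MeasurableSet ({x | (s : EReal) ≤ φ x}ᶜ) := (level_closed h s).measurableSet.compl
  calc ENNReal.ofReal ((K - s) * δ) = ENNReal.ofReal (K - s) * ENNReal.ofReal δ :=
        ENNReal.ofReal_mul (by linarith)
    _ ≤ ENNReal.ofReal (K - s) * Q ({x | (s : EReal) ≤ φ x}ᶜ) := by gcongr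
    _ = ∫⁻ x in {x | (s : EReal) ≤ φ x}ᶜ, ENNReal.ofReal (K - s) ∂Q := by
        rw [setLIntegral_const]
    _ ≤ ∫⁻ x in {x | (s : EReal) ≤ φ x}ᶜ, ((K : EReal) - φ x).toENNReal ∂Q := by
        refine setLIntegral_mono' hms fun x hx => ?_
        rw [← EReal.real_coe_toENNReal]
        apply EReal.toENNReal_le_toENNReal
        have hx' : φ x < (s : EReal) := not_le.1 hx
        rw [EReal.coe_sub]
        exact EReal.sub_le_sub le_rfl hx'.le
    _ ≤ _ := setLIntegral_le_lintegral _ _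

theorem exp_lower {E : Type*} [NormedAddCommGroup E] [NormedSpace ℝ E]
    [MeasureSpace E] [BorelSpace E] {φ : E → EReal} (S : Set E) (hS : MeasurableSet S) (s : ℝ)
    (h : ∀ x ∈ S, (s : EReal) ≤ φ x) :
    ENNReal.ofReal (Real.exp s) * volume S ≤ ∫⁻ x, EReal.exp (φ x) := by
  calc _ = ∫⁻ x in S, ENNReal.ofReal (Real.exp s) := by rw [setLIntegral_const]
    _ ≤ ∫⁻ x in S, EReal.exp (φ x) := by
        refine setLIntegral_mono' hS fun x hx => ?_
        rw [← EReal.exp_coe]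
        exact EReal.exp_monotone (h x hx)
    _ ≤ _ := setLIntegral_le_lintegral _ _

/-- Uniform bounds on functions with large likelihood. -/
theorem apriori {E : Type*} [NormedAddCommGroup E] [NormedSpace ℝ E]
    [FiniteDimensional ℝ E] [MeasureSpace E]
    [BorelSpace E] [(volume : Measure E).IsAddHaarMeasure] (Q : Measure E) [IsProbabilityMeasure Q]
    {x₀ : E} {r δ : ℝ} (hr : 0 < r) (hδ : 0 < δ) (hδ1 : δ ≤ 1)
    (hg : BallGap Q x₀ r δ) (a : ℝ) :
    ∃ K s₀ : ℝ, 0 ≤ K ∧ ∀ φ : E → EReal, IsPhi φ → (a : EReal) ≤ Lfun φ Q →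
      (∀ x, φ x ≤ (K : EReal)) ∧ ∀ b ∈ Metric.closedBall x₀ r, (s₀ : EReal) ≤ φ b := by
  have := FiniteDimensional.proper_real E
  set v : ℝ≥0∞ := volume (Metric.ball (0 : E) (δ / 4 * r)) with hv
  have hv0 : v ≠ 0 := (Metric.measure_ball_pos _ _ (by positivity)).ne'
  have hvt : v ≠ ⊤ := measure_ball_lt_top.ne
  set w : ℝ := v.toReal with hw
  have hw0 : 0 < w := ENNReal.toReal_pos hv0 hvt
  have hvw : v = ENNReal.ofReal w := (ENNReal.ofReal_toReal hvt).symm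
  set K : ℝ := max 1 (max (1 - a) (8 * (2 + |a|) / w)) with hKdef
  have hK1 : 1 ≤ K := le_max_left _ _
  have hK2 : 1 - a ≤ K := (le_max_left _ _).trans (le_max_right _ _)
  have hK3 : 8 * (2 + |a|) / w ≤ K := (le_max_right _ _).trans (le_max_right _ _)
  have hK0 : 0 ≤ K := by linarith
  have bound : ∀ φ : E → EReal, IsPhi φ → (a : EReal) ≤ Lfun φ Q → ∀ x, φ x ≤ (K : EReal) := by
    intro φ h hL
    obtain ⟨m, hm⟩ := exists_max h
    by_contra hno
    push Not at hno
    obtain ⟨x, hx⟩ := hno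
    have hmK : (K : EReal) < φ m := hx.trans_le (hm x)
    obtain ⟨M, hM⟩ : ∃ M : ℝ, φ m = M :=
      ⟨(φ m).toReal, (EReal.coe_toReal (h.2.1 m) (ne_bot_of_gt hmK)).symm⟩
    rw [hM, EReal.coe_lt_coe_iff] at hmK
    have hM0 : 0 ≤ M := by linarith
    rw [Lfun_rep Q φ h.measurable M hM0 (fun x => hM ▸ hm x)] at hL
    obtain ⟨hJ, hJ0⟩ := J_bound hL
    by_cases hcase : ∀ b ∈ Metric.closedBall x₀ r, ((M - 2 * M / δ : ℝ) : EReal) ≤ φ b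
    · have hI : ∀ z ∈ Metric.ball ((1 - δ / 4) • m + (δ / 4) • x₀) (δ / 4 * r),
          ((M / 2 : ℝ) : EReal) ≤ φ z := by
        intro z hz
        set b := x₀ + (δ / 4)⁻¹ • (z - ((1 - δ / 4) • m + (δ / 4) • x₀)) with hb
        have hbm : b ∈ Metric.closedBall x₀ r := by
          rw [Metric.mem_ball, dist_eq_norm] at hz
          rw [Metric.mem_closedBall, dist_eq_norm, hb, add_sub_cancel_left, norm_smul,
            Real.norm_of_nonneg (by positivity), inv_mul_le_iff₀ (by positivity)]
          exact hz.le
        have hzb : z = (1 - δ / 4) • m + (δ / 4) • b := by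
          rw [hb, smul_add, smul_smul, mul_inv_cancel₀ (by positivity)]
          simp only [one_smul]
          abel
        have := conc_real h (a := 1 - δ / 4) (b := δ / 4) (by linarith) (by linarith) (by ring)
          (le_of_eq hM.symm) (hcase b hbm)
        rw [← hzb] at this
        convert this using 2
        field_simp
        ring
      have h1 := exp_lower (φ := φ) _ Metric.isOpen_ball.measurableSet (M / 2) hI
      rw [Measure.addHaar_ball_center, ← hv, hvw, ← ENNReal.ofReal_mul (Real.exp_pos _).le] at h1
      have h2 := h1.trans (le_add_self.trans hJ)
      rw [ENNReal.ofReal_le_ofReal_iff hJ0] at h2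
      have h3 := Real.quadratic_le_exp_of_nonneg (x := M / 2) (by linarith)
      have h4 : M ^ 2 / 8 ≤ Real.exp (M / 2) := by nlinarith
      have h5 : M ^ 2 / 8 * w ≤ M + 1 - a := (mul_le_mul_of_nonneg_right h4 hw0.le).trans h2
      rw [div_le_iff₀ hw0] at hK3
      have h6 : 8 * (2 + |a|) < M * w := hK3.trans_lt (mul_lt_mul_of_pos_right hmK hw0)
      have h7 := neg_abs_le a
      have h8 := abs_nonneg a
      nlinarith
    · push Not at hcase
      obtain ⟨b, hb, hlt⟩ := hcase
      have hle : M - 2 * M / δ ≤ M := by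
        have : 0 ≤ 2 * M / δ := by positivity
        linarith
      have h1 := gap_H Q hg h M _ hle hb hlt
      have h2 := h1.trans (le_self_add.trans hJ)
      rw [ENNReal.ofReal_le_ofReal_iff hJ0] at h2
      have h3 : (M - (M - 2 * M / δ)) * δ = 2 * M := by field_simp; ring
      rw [h3] at h2
      linarith
  refine ⟨K, min K (K - (K + 1 - a) / δ) - 1, hK0, fun φ h hL => ⟨bound φ h hL, ?_⟩⟩
  intro b hb
  by_contra hlt
  push Not at hlt
  rw [Lfun_rep Q φ h.measurable K hK0 (bound φ h hL)] at hL
  obtain ⟨hJ, hJ0⟩ := J_bound hL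
  have hm1 := min_le_left K (K - (K + 1 - a) / δ)
  have hm2 := min_le_right K (K - (K + 1 - a) / δ)
  have h1 := gap_H Q hg h K _ (by linarith) hb hlt
  have h2 := h1.trans (le_self_add.trans hJ)
  rw [ENNReal.ofReal_le_ofReal_iff hJ0] at h2
  have h3 : ((K + 1 - a) / δ + 1) * δ = K + 1 - a + δ := by field_simp
  have h4 : ((K + 1 - a) / δ + 1) * δ ≤ (K - (min K (K - (K + 1 - a) / δ) - 1)) * δ :=
    mul_le_mul_of_nonneg_right (by linarith) hδ.le
  linarith


theorem convex_bounded {E : Type*} [NormedAddCommGroup E] [NormedSpace ℝ E]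
    [FiniteDimensional ℝ E] [MeasureSpace E]
    [BorelSpace E] [(volume : Measure E).IsAddHaarMeasure] {D : Set E} (hD : Convex ℝ D)
    {x₀ : E} {r : ℝ} (hr : 0 < r) (hsub : Metric.closedBall x₀ r ⊆ D)
    (hfin : (volume : Measure E) D ≠ ⊤) : ∃ R : ℝ, ∀ x ∈ D, ‖x - x₀‖ < R := by
  set v : ℝ≥0∞ := volume (Metric.ball (0 : E) (r / 2)) with hv
  have hv0 : v ≠ 0 := (Metric.measure_ball_pos _ _ (by positivity)).ne'
  obtain ⟨N, hN⟩ := ENNReal.exists_nat_mul_gt hv0 hfin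
  refine ⟨2 * r * (N + 1), fun x hx => ?_⟩
  by_contra hlt
  push Not at hlt
  have hxpos : 0 < ‖x - x₀‖ := lt_of_lt_of_le (by positivity) hlt
  let c : ℕ → E := fun i => x₀ + ((i : ℝ) * r / ‖x - x₀‖) • (x - x₀)
  have hball : ∀ i ∈ Finset.range N, Metric.ball (c i) (r / 2) ⊆ D := by
    intro i hi z hz
    have hiN : (i : ℝ) ≤ N := by exact_mod_cast (Finset.mem_range.1 hi).le
    set l : ℝ := (i : ℝ) * r / ‖x - x₀‖ with hl
    have hl0 : 0 ≤ l := by positivity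
    have hl2 : l ≤ 1 / 2 := by
      rw [hl, div_le_iff₀ hxpos]
      nlinarith
    have hl1 : 0 < 1 - l := by linarith
    set y := x₀ + (1 - l)⁻¹ • (z - c i) with hy
    have hyD : y ∈ D := by
      apply hsub
      rw [Metric.mem_ball, dist_eq_norm] at hz
      rw [Metric.mem_closedBall, dist_eq_norm, hy, add_sub_cancel_left, norm_smul,
        Real.norm_of_nonneg (by positivity), inv_mul_le_iff₀ hl1]
      nlinarith
    have hzz : z = l • x + (1 - l) • y := by
      have hci : c i = x₀ + l • (x - x₀) := rfl
      rw [hy, smul_add, smul_smul, mul_inv_cancel₀ hl1.ne', hci]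
      module
    rw [hzz]
    exact hD hx hyD hl0 hl1.le (by ring)
  have hdisj : (↑(Finset.range N) : Set ℕ).PairwiseDisjoint (fun i => Metric.ball (c i) (r / 2)) := by
    intro i _ j _ hij
    refine Metric.ball_disjoint_ball ?_
    have : c i - c j = (((i : ℝ) - j) * r / ‖x - x₀‖) • (x - x₀) := by
      simp only [c]
      module
    rw [dist_eq_norm, this, norm_smul, Real.norm_eq_abs, abs_div, abs_mul, abs_norm,
      div_mul_cancel₀ _ hxpos.ne', abs_of_pos hr]
    have h1 : (1 : ℝ) ≤ |(i : ℝ) - j| := by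
      have h2 : (1 : ℤ) ≤ |(i : ℤ) - j| := Int.one_le_abs (sub_ne_zero.2 (by exact_mod_cast hij))
      exact_mod_cast h2
    nlinarith
  have hle : (N : ℝ≥0∞) * v ≤ volume D := by
    calc (N : ℝ≥0∞) * v = ∑ i ∈ Finset.range N, volume (Metric.ball (c i) (r / 2)) := by
          simp only [Measure.addHaar_ball_center, ← hv]
          simp
      _ = volume (⋃ i ∈ Finset.range N, Metric.ball (c i) (r / 2)) :=
          (measure_biUnion_finset hdisj fun i _ => Metric.isOpen_ball.measurableSet).symm
      _ ≤ _ := measure_mono (iUnion₂_subset hball)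
  exact absurd hN (not_lt.2 hle)

theorem exists_limit {E : Type*} [NormedAddCommGroup E] [NormedSpace ℝ E]
    [FiniteDimensional ℝ E] (φ : ℕ → E → EReal) (hφ : ∀ n, IsPhi (φ n)) (K s₀ : ℝ)
    (hK : ∀ n x, φ n x ≤ (K : EReal)) {x₀ : E} {r : ℝ} (hr : 0 < r)
    (hs : ∀ n, ∀ b ∈ Metric.closedBall x₀ r, (s₀ : EReal) ≤ φ n b) :
    ∃ (σ : ℕ → ℕ) (ψ : E → EReal), StrictMono σ ∧ UpperSemicontinuous ψ ∧
      (∀ x, ψ x ≤ (K : EReal)) ∧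
      (∀ x y : E, ∀ a b : ℝ, 0 < a → 0 < b → a + b = 1 →
        (a : EReal) * ψ x + (b : EReal) * ψ y ≤ ψ (a • x + b • y)) ∧
      (∀ x, ∀ c : EReal, ψ x < c → ∀ᶠ n in atTop, φ (σ n) x < c) ∧
      (∀ l : ℝ, 0 < l → l < 1 → ∀ x, ∀ s : ℝ, (s : EReal) < ψ x →
        ∀ᶠ n in atTop, (((1 - l) * s + l * s₀ : ℝ) : EReal) ≤ φ (σ n) ((1 - l) • x + l • x₀)) := by
  have := FiniteDimensional.proper_real E
  let B := TopologicalSpace.countableBasis E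
  have hB : TopologicalSpace.IsTopologicalBasis B := TopologicalSpace.isBasis_countableBasis E
  have : Countable B := (TopologicalSpace.countable_countableBasis E).to_subtype
  obtain ⟨A, σ, hσ, hA⟩ := CompactSpace.tendsto_subseq
    (fun n => fun U : B => ⨆ x ∈ (U : Set E), φ n x)
  rw [tendsto_pi_nhds] at hA
  have hA' : ∀ U : B, Tendsto (fun n => ⨆ x ∈ (U : Set E), φ (σ n) x) atTop (𝓝 (A U)) := hA
  let ψ : E → EReal := fun x => ⨅ (U : B) (_ : x ∈ (U : Set E)), A U
  have hψle : ∀ x (U : B), x ∈ (U : Set E) → ψ x ≤ A U := fun x U hx => iInf₂_le U hx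
  have hψex : ∀ x c, ψ x < c → ∃ U : B, x ∈ (U : Set E) ∧ A U < c := by
    intro x c hc
    simp only [ψ, iInf_lt_iff] at hc
    obtain ⟨U, hU, h⟩ := hc
    exact ⟨U, hU, h⟩
  have hAK : ∀ U, A U ≤ (K : EReal) := fun U =>
    le_of_tendsto' (hA' U) fun n => iSup₂_le fun x _ => hK _ x
  have hψK : ∀ x, ψ x ≤ (K : EReal) := by
    intro x
    obtain ⟨U, hU, hxU, -⟩ := hB.exists_subset_of_mem_open (mem_univ x) isOpen_univ
    exact (hψle x ⟨U, hU⟩ hxU).trans (hAK _)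
  have hψtop : ∀ x, ψ x ≠ ⊤ := fun x h => by
    have := hψK x
    rw [h, top_le_iff] at this
    exact EReal.coe_ne_top _ this
  have hpick : ∀ (U : B) (s : ℝ), (s : EReal) < A U →
      ∀ᶠ n in atTop, ∃ x ∈ (U : Set E), (s : EReal) < φ (σ n) x := by
    intro U s h
    filter_upwards [(hA' U).eventually (lt_mem_nhds h)] with n hn
    simp only [lt_iSup_iff] at hn
    obtain ⟨x, hx, h⟩ := hn
    exact ⟨x, hx, h⟩
  refine ⟨σ, ψ, hσ, ?_, hψK, ?_, ?_, ?_⟩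
  · intro x c hc
    obtain ⟨U, hxU, hU⟩ := hψex x c hc
    filter_upwards [(hB.isOpen U.2).mem_nhds hxU] with y hy
    exact (hψle y U hy).trans_lt hU
  · refine conc_of_real hψtop ?_
    intro x y a b s t ha hb hab hsx hty
    refine le_iInf₂ fun U hU => ?_
    have hc : Continuous (fun p : E × E => a • p.1 + b • p.2) := by fun_prop
    have hnh : (fun p : E × E => a • p.1 + b • p.2) ⁻¹' (U : Set E) ∈ 𝓝 (x, y) :=
      hc.continuousAt.preimage_mem_nhds ((hB.isOpen U.2).mem_nhds hU)
    rw [nhds_prod_eq] at hnh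
    obtain ⟨V₁, hV₁, V₂, hV₂, hVV⟩ := mem_prod_iff.1 hnh
    obtain ⟨W₁, hW₁, hx₁, hWV₁⟩ := hB.mem_nhds_iff.1 hV₁
    obtain ⟨W₂, hW₂, hy₂, hWV₂⟩ := hB.mem_nhds_iff.1 hV₂
    have hev : ∀ ε : ℝ, 0 < ε → ((a * s + b * t - ε : ℝ) : EReal) ≤ A U := by
      intro ε hε
      have h1 : ((s - ε : ℝ) : EReal) < A ⟨W₁, hW₁⟩ :=
        lt_of_lt_of_le (by rw [EReal.coe_lt_coe_iff]; linarith) (hsx.trans (hψle x ⟨W₁, hW₁⟩ hx₁))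
      have h2 : ((t - ε : ℝ) : EReal) < A ⟨W₂, hW₂⟩ :=
        lt_of_lt_of_le (by rw [EReal.coe_lt_coe_iff]; linarith) (hty.trans (hψle y ⟨W₂, hW₂⟩ hy₂))
      refine ge_of_tendsto (hA' U) ?_
      filter_upwards [hpick _ _ h1, hpick _ _ h2] with n hn1 hn2
      obtain ⟨x', hx', hx2⟩ := hn1
      obtain ⟨y', hy', hy2⟩ := hn2
      have h3 := conc_real (hφ (σ n)) ha hb hab hx2.le hy2.le
      have h4 : a * (s - ε) + b * (t - ε) = a * s + b * t - ε := by
        have : a * ε + b * ε = ε := by rw [← add_mul, hab, one_mul]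
        linarith
      rw [h4] at h3
      refine h3.trans (le_iSup₂ (f := fun x (_ : x ∈ (U : Set E)) => φ (σ n) x) _ ?_)
      exact hVV (mk_mem_prod (hWV₁ hx') (hWV₂ hy'))
    refine EReal.ge_of_forall_gt_iff_ge.1 fun z hz => ?_
    rw [EReal.coe_lt_coe_iff] at hz
    have := hev (a * s + b * t - z) (by linarith)
    simpa using this
  · intro x c hc
    obtain ⟨U, hxU, hU⟩ := hψex x c hc
    filter_upwards [(hA' U).eventually (gt_mem_nhds hU)] with n hn
    exact (le_iSup₂ (f := fun x (_ : x ∈ (U : Set E)) => φ (σ n) x) x hxU).trans_lt hn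
  · intro l hl0 hl1 x s hsx
    have hc : Continuous (fun x' : E => x₀ + ((1 - l) / l) • (x - x')) := by fun_prop
    have hnh : (fun x' : E => x₀ + ((1 - l) / l) • (x - x')) ⁻¹' Metric.closedBall x₀ r ∈ 𝓝 x := by
      apply hc.continuousAt.preimage_mem_nhds
      simp only [sub_self, smul_zero, add_zero]
      exact Metric.closedBall_mem_nhds _ hr
    obtain ⟨W, hW, hxW, hWs⟩ := hB.mem_nhds_iff.1 hnh
    filter_upwards [hpick ⟨W, hW⟩ s (hsx.trans_le (hψle x ⟨W, hW⟩ hxW))] with n hn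
    obtain ⟨x', hx', hx2⟩ := hn
    have h3 := conc_real (hφ (σ n)) (a := 1 - l) (b := l) (by linarith) hl0 (by ring) hx2.le
      (hs (σ n) _ (hWs hx'))
    convert h3 using 2
    rw [smul_add, smul_smul, mul_div_cancel₀ _ hl0.ne']
    module


theorem lintegral_contract {E : Type*} [NormedAddCommGroup E] [NormedSpace ℝ E]
    [FiniteDimensional ℝ E] [MeasureSpace E]
    [BorelSpace E] [(volume : Measure E).IsAddHaarMeasure] (g : E → ℝ≥0∞) (hg : Measurable g)
    (c : ℝ) (hc : c ≠ 0) (y : E) :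
    ∫⁻ x, g (c • x + y) = ENNReal.ofReal |(c ^ Module.finrank ℝ E)⁻¹| * ∫⁻ x, g x := by
  have h1 : ∫⁻ x, g (c • x + y) = ∫⁻ z, g (z + y) ∂(Measure.map (c • ·) (volume : Measure E)) := by
    exact (lintegral_map (f := fun z => g (z + y))
      (hg.comp (measurable_add_const y) : Measurable fun z => g (z + y))
      (measurable_const_smul c)).symm
  rw [h1, Measure.map_addHaar_smul _ hc, lintegral_smul_measure, lintegral_add_right_eq_self]
  rfl

theorem exp_fatou {E : Type*} [NormedAddCommGroup E] [NormedSpace ℝ E]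
    [FiniteDimensional ℝ E] [MeasureSpace E]
    [BorelSpace E] [(volume : Measure E).IsAddHaarMeasure] (φ : ℕ → E → EReal)
    (hφ : ∀ n, Measurable (φ n)) (ψ : E → EReal) (s₀ : ℝ) (x₀ : E)
    (h : ∀ l : ℝ, 0 < l → l < 1 → ∀ x, ∀ s : ℝ, (s : EReal) < ψ x →
        ∀ᶠ n in atTop, (((1 - l) * s + l * s₀ : ℝ) : EReal) ≤ φ n ((1 - l) • x + l • x₀)) :
    ∫⁻ x, EReal.exp (ψ x) ≤ liminf (fun n => ∫⁻ x, EReal.exp (φ n x)) atTop := by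
  let l : ℕ → ℝ := fun j => 1 / ((j : ℝ) + 2)
  have hl0 : ∀ j, 0 < l j := fun j => by simp only [l]; positivity
  have hl1 : ∀ j, l j < 1 := fun j => by
    simp only [l]
    rw [div_lt_one (by positivity)]
    have : (0 : ℝ) ≤ j := by positivity
    linarith
  have hlim : Tendsto l atTop (𝓝 0) := by
    have h1 := (tendsto_one_div_add_atTop_nhds_zero_nat (𝕜 := ℝ)).comp (tendsto_add_atTop_nat 1)
    refine h1.congr fun j => ?_
    simp only [l, Function.comp]
    push_cast
    ring_nf
  let F : ℕ → E → ℝ≥0∞ := fun j x =>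
    liminf (fun n => EReal.exp (φ n ((1 - l j) • x + l j • x₀))) atTop
  have hmeas : ∀ j n, Measurable (fun x : E => EReal.exp (φ n ((1 - l j) • x + l j • x₀))) := by
    intro j n
    refine ((hφ n).comp ?_).ereal_exp
    exact Continuous.measurable (by fun_prop)
  have hFm : ∀ j, Measurable (F j) := fun j => Measurable.liminf (hmeas j)
  set I := liminf (fun n => ∫⁻ x, EReal.exp (φ n x)) atTop with hI
  let c : ℕ → ℝ≥0∞ := fun j => ENNReal.ofReal |((1 - l j) ^ Module.finrank ℝ E)⁻¹|
  have hF : ∀ j, ∫⁻ x, F j x ≤ c j * I := by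
    intro j
    refine (lintegral_liminf_le (hmeas j)).trans ?_
    rw [hI, ← ENNReal.liminf_const_mul_of_ne_top ENNReal.ofReal_ne_top]
    refine le_of_eq ?_
    congr 1
    ext n
    exact lintegral_contract (fun x => EReal.exp (φ n x)) (hφ n).ereal_exp (1 - l j)
      (by have := hl1 j; linarith) _
  have hc : Tendsto c atTop (𝓝 1) := by
    have h1 : Tendsto (fun j => |((1 - l j) ^ Module.finrank ℝ E)⁻¹|) atTop
        (𝓝 |((1 - 0) ^ Module.finrank ℝ E)⁻¹|) := by
      refine Tendsto.abs (Tendsto.inv₀ ((tendsto_const_nhds.sub hlim).pow _) (by simp))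
    have h2 := ENNReal.tendsto_ofReal h1
    have e : ENNReal.ofReal |((1 - 0 : ℝ) ^ Module.finrank ℝ E)⁻¹| = 1 := by simp
    rw [e] at h2
    exact h2
  have hcI : Tendsto (fun j => c j * I) atTop (𝓝 I) := by
    have := ENNReal.Tendsto.mul_const (b := I) hc (Or.inl one_ne_zero)
    simpa using this
  calc ∫⁻ x, EReal.exp (ψ x) ≤ ∫⁻ x, liminf (fun j => F j x) atTop := by
        refine lintegral_mono fun x => ?_
        refine le_of_forall_lt fun b hb => ?_
        have hb2 : ENNReal.log b < ψ x := by
          rw [← EReal.exp_lt_exp_iff, ENNReal.exp_log]; exact hb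
        obtain ⟨s, hbs, hsψ⟩ := EReal.lt_iff_exists_real_btwn.1 hb2
        have hbs2 : b < EReal.exp s := by
          rw [← EReal.exp_lt_exp_iff, ENNReal.exp_log] at hbs; exact hbs
        have hj : ∀ j, ENNReal.ofReal (Real.exp ((1 - l j) * s + l j * s₀)) ≤ F j x := by
          intro j
          refine le_liminf_of_le (by isBoundedDefault) ?_
          filter_upwards [h (l j) (hl0 j) (hl1 j) x s hsψ] with n hn
          rw [← EReal.exp_coe]
          exact EReal.exp_monotone hn
        have ht : Tendsto (fun j => ENNReal.ofReal (Real.exp ((1 - l j) * s + l j * s₀))) atTop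
            (𝓝 (ENNReal.ofReal (Real.exp ((1 - 0) * s + 0 * s₀)))) := by
          apply ENNReal.tendsto_ofReal
          refine (Real.continuous_exp.tendsto _).comp ?_
          exact ((tendsto_const_nhds.sub hlim).mul_const s).add (hlim.mul_const s₀)
        have h3 := liminf_le_liminf (f := atTop) (Eventually.of_forall hj)
          (by isBoundedDefault) (by isBoundedDefault)
        rw [ht.liminf_eq] at h3
        refine lt_of_lt_of_le hbs2 (le_trans (le_of_eq ?_) h3)
        simp
    _ ≤ liminf (fun j => ∫⁻ x, F j x) atTop := lintegral_liminf_le hFm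
    _ ≤ liminf (fun j => c j * I) atTop := liminf_le_liminf (Eventually.of_forall hF)
          (by isBoundedDefault) (by isBoundedDefault)
    _ = I := hcI.liminf_eq

theorem combine {H I C : ℝ≥0∞} {Hn In : ℕ → ℝ≥0∞} (h1 : H ≤ liminf Hn atTop)
    (h2 : I ≤ liminf In atTop) (h3 : ∀ᶠ n in atTop, Hn n + In n ≤ C) : H + I ≤ C := by
  rw [liminf_eq_iSup_iInf_of_nat] at h1 h2
  refine (add_le_add h1 h2).trans ?_
  rw [ENNReal.iSup_add_iSup_of_monotone]
  · refine iSup_le fun n => ?_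
    obtain ⟨m, hm, hmn⟩ := (h3.and (eventually_ge_atTop n)).exists
    exact (add_le_add (iInf₂_le m hmn) (iInf₂_le m hmn)).trans hm
  · exact fun i j hij => biInf_mono fun k hk => le_trans hij hk
  · exact fun i j hij => biInf_mono fun k hk => le_trans hij hk

theorem level_bounded_coercive {E : Type*} [NormedAddCommGroup E] [NormedSpace ℝ E]
    [FiniteDimensional ℝ E] [MeasureSpace E]
    [BorelSpace E] [(volume : Measure E).IsAddHaarMeasure] (ψ : E → EReal)
    (husc : UpperSemicontinuous ψ)
    (hconc : ∀ x y : E, ∀ a b : ℝ, 0 < a → 0 < b → a + b = 1 →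
        (a : EReal) * ψ x + (b : EReal) * ψ y ≤ ψ (a • x + b • y))
    (s₀ : ℝ) {x₀ : E} {r : ℝ} (hr : 0 < r)
    (hs : ∀ b ∈ Metric.closedBall x₀ r, (s₀ : EReal) ≤ ψ b)
    (hfin : (∫⁻ x, EReal.exp (ψ x)) ≠ ⊤) :
    Tendsto ψ (Filter.comap (fun x : E => ‖x‖) atTop) (𝓝 ⊥) := by
  rw [EReal.tendsto_nhds_bot_iff_real]
  intro s
  set s' := min s s₀ with hs'
  have hconv : Convex ℝ {x | (s' : EReal) ≤ ψ x} := by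
    rw [convex_iff_forall_pos]
    intro x hx y hy a b ha hb hab
    refine le_trans ?_ (hconc x y a b ha hb hab)
    have ha' : (0 : EReal) ≤ (a : EReal) := by exact_mod_cast ha.le
    have hb' : (0 : EReal) ≤ (b : EReal) := by exact_mod_cast hb.le
    refine le_trans ?_ (add_le_add (mul_le_mul_of_nonneg_left hx ha')
      (mul_le_mul_of_nonneg_left hy hb'))
    rw [← EReal.coe_mul, ← EReal.coe_mul, ← EReal.coe_add, ← add_mul, hab, one_mul]
  have hsub : Metric.closedBall x₀ r ⊆ {x | (s' : EReal) ≤ ψ x} := fun b hb =>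
    le_trans (by rw [EReal.coe_le_coe_iff]; exact min_le_right _ _) (hs b hb)
  have hcl : IsClosed {x | (s' : EReal) ≤ ψ x} := husc.isClosed_preimage _
  have hvol : (volume : Measure E) {x | (s' : EReal) ≤ ψ x} ≠ ⊤ := by
    intro ht
    have := exp_lower (φ := ψ) {x | (s' : EReal) ≤ ψ x} hcl.measurableSet s' (fun x hx => hx)
    rw [ht, ENNReal.mul_top (by simp [Real.exp_pos]), top_le_iff] at this
    exact hfin this
  obtain ⟨R, hR⟩ := convex_bounded hconv hr hsub hvol
  rw [eventually_comap]
  filter_upwards [eventually_ge_atTop (R + ‖x₀‖)] with n hn x hx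
  by_contra hcon
  push Not at hcon
  have h1 := hR x (le_trans (by rw [EReal.coe_le_coe_iff]; exact min_le_left _ _) hcon)
  have h2 : ‖x‖ ≤ ‖x - x₀‖ + ‖x₀‖ := by
    have := norm_add_le (x - x₀) x₀
    simpa using this
  have h3 : ‖x‖ = n := hx
  linarith

theorem exists_MLE {E : Type*} [NormedAddCommGroup E] [NormedSpace ℝ E]
    [FiniteDimensional ℝ E] [MeasureSpace E]
    [BorelSpace E] [(volume : Measure E).IsAddHaarMeasure] (Q : Measure E) [IsProbabilityMeasure Q]
    {x₀ : E} {r δ : ℝ} (hr : 0 < r) (hδ : 0 < δ) (hδ1 : δ ≤ 1)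
    (hg : BallGap Q x₀ r δ) (hL : Lprof Q ≠ ⊥) : ∃ ψ, IsPhi ψ ∧ Lprof Q ≤ Lfun ψ Q := by
  obtain ⟨a, -, ha⟩ := EReal.lt_iff_exists_real_btwn.1 (bot_lt_iff_ne_bot.2 hL)
  obtain ⟨K, s₀, hK0, hap⟩ := apriori Q hr hδ hδ1 hg a
  have hLs : Lprof Q = sSup ((fun φ : E → EReal => Lfun φ Q) '' {φ | IsPhi φ}) := by
    rw [sSup_image]; rfl
  obtain ⟨u, hmono, hu, huS⟩ := exists_seq_tendsto_sSup
    (S := (fun φ : E → EReal => Lfun φ Q) '' {φ | IsPhi φ})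
    ⟨_, testFun univ 0, testFun_isPhi univ isClosed_univ convex_univ 0, rfl⟩ (OrderTop.bddAbove _)
  rw [← hLs] at hu
  obtain ⟨N, hN⟩ := (hu.eventually (lt_mem_nhds ha)).exists
  choose f hf hfu using huS
  have hlarge : ∀ n, (a : EReal) ≤ Lfun (f (n + N)) Q := fun n => by
    have h1 : Lfun (f (n + N)) Q = u (n + N) := hfu _
    rw [h1]
    exact hN.le.trans (hmono (Nat.le_add_left N n))
  obtain ⟨σ, ψ, hσ, husc, hψK, hconc, hup, hlow⟩ := exists_limit (fun n => f (n + N))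
    (fun n => hf _) K s₀ (fun n => (hap _ (hf _) (hlarge n)).1) hr
    (fun n => (hap _ (hf _) (hlarge n)).2)
  set g : ℕ → E → EReal := fun n => f (σ n + N) with hgdef
  have hgphi : ∀ n, IsPhi (g n) := fun n => hf _
  have hgK : ∀ n x, g n x ≤ (K : EReal) := fun n => (hap _ (hf _) (hlarge _)).1
  have hgs : ∀ n, ∀ b ∈ Metric.closedBall x₀ r, (s₀ : EReal) ≤ g n b :=
    fun n => (hap _ (hf _) (hlarge _)).2
  have hglim : Tendsto (fun n => Lfun (g n) Q) atTop (𝓝 (Lprof Q)) := by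
    have h1 : Tendsto (fun n => σ n + N) atTop atTop :=
      (tendsto_add_atTop_nat N).comp hσ.tendsto_atTop
    refine (hu.comp h1).congr fun n => ?_
    exact (hfu _).symm
  have hI := exp_fatou g (fun n => (hgphi n).measurable) ψ s₀ x₀ hlow
  have hH : ∫⁻ x, ((K : EReal) - ψ x).toENNReal ∂Q ≤
      liminf (fun n => ∫⁻ x, ((K : EReal) - g n x).toENNReal ∂Q) atTop := by
    have hm : ∀ n, Measurable (fun x => ((K : EReal) - g n x).toENNReal) := fun n =>
      (measurable_const.sub (hgphi n).measurable).ereal_toENNReal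
    refine le_trans (lintegral_mono fun x => ?_) (lintegral_liminf_le hm)
    have hψt : ψ x ≠ ⊤ := ne_top_of_le_ne_top (EReal.coe_ne_top K) (hψK x)
    refine le_of_forall_lt fun b hb => ?_
    by_contra hcon
    have hex : ∃ c : EReal, ψ x < c ∧ b < ((K : EReal) - c).toENNReal := by
      have hcont : ContinuousAt (fun y : EReal => ((K : EReal) - y).toENNReal) (ψ x) := by
        have hc0 : ContinuousAt (fun y : EReal => (K : EReal) + -y) (ψ x) := by
          refine ContinuousAt.comp (f := fun y : EReal => ((K : EReal), -y))
            (g := fun p : EReal × EReal => p.1 + p.2)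
            (EReal.continuousAt_add (Or.inl (EReal.coe_ne_top K)) (Or.inl (EReal.coe_ne_bot K))) ?_
          exact continuousAt_const.prodMk continuous_neg.continuousAt
        exact EReal.continuous_toENNReal.continuousAt.comp hc0
      have hev := hcont.eventually (lt_mem_nhds hb)
      have hev2 : ∀ᶠ y in 𝓝[>] (ψ x), b < ((K : EReal) - y).toENNReal :=
        hev.filter_mono nhdsWithin_le_nhds
      have : (𝓝[>] (ψ x)).NeBot := nhdsGT_neBot_of_exists_gt ⟨⊤, lt_top_iff_ne_top.2 hψt⟩
      obtain ⟨y, hy, hy2⟩ := (hev2.and self_mem_nhdsWithin).exists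
      exact ⟨y, hy2, hy⟩
    obtain ⟨c, hc, hbc⟩ := hex
    apply hcon
    refine lt_of_lt_of_le hbc ?_
    refine le_liminf_of_le (by isBoundedDefault) ?_
    filter_upwards [hup x c hc] with n hn
    exact EReal.toENNReal_le_toENNReal (EReal.sub_le_sub le_rfl hn.le)
  have hJ : ∀ c : ℝ, (c : EReal) < Lprof Q →
      ∫⁻ x, ((K : EReal) - ψ x).toENNReal ∂Q + ∫⁻ x, EReal.exp (ψ x) ≤ ENNReal.ofReal (K + 1 - c)
      ∧ 0 ≤ K + 1 - c := by
    intro c hc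
    have hev : ∀ᶠ n in atTop, (∫⁻ x, ((K : EReal) - g n x).toENNReal ∂Q
        + ∫⁻ x, EReal.exp (g n x) ≤ ENNReal.ofReal (K + 1 - c)) ∧ 0 ≤ K + 1 - c := by
      filter_upwards [hglim.eventually (lt_mem_nhds hc)] with n hn
      have h1 := hn.le
      rw [Lfun_rep Q (g n) (hgphi n).measurable K hK0 (hgK n)] at h1
      exact J_bound h1
    exact ⟨combine hH hI (hev.mono fun n h => h.1), hev.exists.choose_spec.2⟩
  have hψs : ∀ b ∈ Metric.closedBall x₀ r, (s₀ : EReal) ≤ ψ b := by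
    intro b hb
    by_contra hcon
    push Not at hcon
    obtain ⟨n, hn⟩ := (hup b s₀ hcon).exists
    exact absurd hn (not_lt.2 (hgs n b hb))
  have hfin : (∫⁻ x, EReal.exp (ψ x)) ≠ ⊤ :=
    ne_top_of_le_ne_top ENNReal.ofReal_ne_top (le_add_self.trans (hJ a ha).1)
  have hψphi : IsPhi ψ := ⟨husc, fun x => ne_top_of_le_ne_top (EReal.coe_ne_top K) (hψK x), hconc,
    level_bounded_coercive ψ husc hconc s₀ hr hψs hfin⟩
  refine ⟨ψ, hψphi, ?_⟩
  refine EReal.ge_of_forall_gt_iff_ge.1 fun c hc => ?_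
  rw [Lfun_rep Q ψ hψphi.measurable K hK0 hψK]
  obtain ⟨h1, h2⟩ := hJ c hc
  have h3 : ((∫⁻ x, ((K : EReal) - ψ x).toENNReal ∂Q + ∫⁻ x, EReal.exp (ψ x) : ℝ≥0∞) : EReal)
      ≤ ((K + 1 - c : ℝ) : EReal) := by
    refine (EReal.coe_ennreal_le_coe_ennreal_iff.2 h1).trans (le_of_eq ?_)
    rw [EReal.coe_ennreal_ofReal, max_eq_left h2]
  refine le_trans (le_of_eq ?_) (EReal.sub_le_sub (le_refl ((K + 1 : ℝ) : EReal)) h3)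
  rw [← EReal.coe_sub]
  congr 1
  ring


theorem mul_ne_bot_aux {t : ℝ} (ht : 0 < t) {x : EReal} (hx : x ≠ ⊥) : (t : EReal) * x ≠ ⊥ := by
  induction x with
  | bot => exact absurd rfl hx
  | coe a => rw [← EReal.coe_mul]; exact EReal.coe_ne_bot _
  | top => rw [EReal.coe_mul_top_of_pos ht]; simp

theorem real_aux {a b : ℝ} (ha : 0 < a) (hb : 0 < b) {A B x y : EReal} (hA : A ≠ ⊥) (hA' : A ≠ ⊤)
    (hB : B ≠ ⊥) (hB' : B ≠ ⊤) (hx : x ≤ A) (hy : y ≤ B)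
    (h : (a : EReal) * A + (b : EReal) * B ≤ (a : EReal) * x + (b : EReal) * y) :
    A ≤ x ∧ B ≤ y := by
  lift A to ℝ using ⟨hA', hA⟩
  lift B to ℝ using ⟨hB', hB⟩
  induction x with
  | bot =>
    rw [EReal.coe_mul_bot_of_pos ha, EReal.bot_add, ← EReal.coe_mul, ← EReal.coe_mul,
      ← EReal.coe_add, le_bot_iff] at h
    exact absurd h (EReal.coe_ne_bot _)
  | top => exact absurd hx (by simp)
  | coe x =>
    induction y with
    | bot =>
      rw [EReal.coe_mul_bot_of_pos hb, EReal.add_bot, ← EReal.coe_mul, ← EReal.coe_mul,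
        ← EReal.coe_add, le_bot_iff] at h
      exact absurd h (EReal.coe_ne_bot _)
    | top => exact absurd hy (by simp)
    | coe y =>
      norm_cast at *
      constructor
      · by_contra hc
        push Not at hc
        nlinarith [mul_le_mul_of_nonneg_left hy hb.le, mul_lt_mul_of_pos_left hc ha]
      · by_contra hc
        push Not at hc
        nlinarith [mul_le_mul_of_nonneg_left hx ha.le, mul_lt_mul_of_pos_left hc hb]

/-- **Convexity of the profile log-likelihood.** For `Q₀, Q₁` with finite first moments and
`0 < t < 1`, `L((1-t)Q₀ + tQ₁) ≤ (1-t)L(Q₀) + tL(Q₁)`; equality with both sides real holds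
iff both `csupp Q₀` and `csupp Q₁` have nonempty interior and `ψ(·|Q₀) = ψ(·|Q₁)`. -/
theorem Lprof_convex {d : ℕ}
    (Q₀ Q₁ : Measure (EuclideanSpace ℝ (Fin d)))
    [IsProbabilityMeasure Q₀] [IsProbabilityMeasure Q₁]
    (h₀ : (∫⁻ x, (‖x‖₊ : ℝ≥0∞) ∂Q₀) ≠ ⊤) (h₁ : (∫⁻ x, (‖x‖₊ : ℝ≥0∞) ∂Q₁) ≠ ⊤)
    (t : ℝ) (ht₀ : 0 < t) (ht₁ : t < 1) :
    Lprof (ENNReal.ofReal (1 - t) • Q₀ + ENNReal.ofReal t • Q₁)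
      ≤ ((1 - t : ℝ) : EReal) * Lprof Q₀ + (t : EReal) * Lprof Q₁ ∧
    ((Lprof (ENNReal.ofReal (1 - t) • Q₀ + ENNReal.ofReal t • Q₁)
        = ((1 - t : ℝ) : EReal) * Lprof Q₀ + (t : EReal) * Lprof Q₁ ∧
      ((1 - t : ℝ) : EReal) * Lprof Q₀ + (t : EReal) * Lprof Q₁ ≠ ⊥ ∧
      ((1 - t : ℝ) : EReal) * Lprof Q₀ + (t : EReal) * Lprof Q₁ ≠ ⊤) ↔
      ((interior (csupp Q₀)).Nonempty ∧ (interior (csupp Q₁)).Nonempty ∧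
        ∃ ψ : EuclideanSpace ℝ (Fin d) → EReal, IsMLE Q₀ ψ ∧ IsMLE Q₁ ψ)) := by
  set P := ENNReal.ofReal (1 - t) • Q₀ + ENNReal.ofReal t • Q₁ with hP
  haveI hPp : IsProbabilityMeasure P := mix_prob Q₀ Q₁ t ht₀ ht₁
  have hmix : ∀ φ, IsPhi φ → Lfun φ P
      = ((1 - t : ℝ) : EReal) * Lfun φ Q₀ + (t : EReal) * Lfun φ Q₁ :=
    fun φ h => Lfun_mix Q₀ Q₁ t ht₀ ht₁ h
  have ha : (0 : EReal) ≤ ((1 - t : ℝ) : EReal) := by exact_mod_cast (by linarith : 0 ≤ 1 - t)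
  have hb : (0 : EReal) ≤ (t : EReal) := by exact_mod_cast ht₀.le
  have hle : Lprof P ≤ ((1 - t : ℝ) : EReal) * Lprof Q₀ + (t : EReal) * Lprof Q₁ := by
    refine iSup₂_le fun φ hφ => ?_
    rw [hmix φ hφ]
    exact add_le_add (mul_le_mul_of_nonneg_left (Lfun_le_Lprof hφ Q₀) ha)
      (mul_le_mul_of_nonneg_left (Lfun_le_Lprof hφ Q₁) hb)
  have hb₀ : Lprof Q₀ ≠ ⊥ := Lprof_ne_bot Q₀ h₀
  have hb₁ : Lprof Q₁ ≠ ⊥ := Lprof_ne_bot Q₁ h₁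
  refine ⟨hle, ?_, ?_⟩
  · rintro ⟨heq, hnb, hnt⟩
    have ht0 : Lprof Q₀ ≠ ⊤ := fun h => hnt (by
      rw [h, EReal.coe_mul_top_of_pos (by linarith)]
      exact EReal.top_add_of_ne_bot (mul_ne_bot_aux ht₀ hb₁))
    have ht1 : Lprof Q₁ ≠ ⊤ := fun h => hnt (by
      rw [h, EReal.coe_mul_top_of_pos ht₀]
      exact EReal.add_top_of_ne_bot (mul_ne_bot_aux (by linarith) hb₀))
    have hi₀ := csupp_interior Q₀ h₀ ht0
    have hi₁ := csupp_interior Q₁ h₁ ht1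
    refine ⟨hi₀, hi₁, ?_⟩
    obtain ⟨x₀, r, δ, hr, hδ, hδ1, hg⟩ := exists_ballGap Q₀ hi₀
    have hg' : BallGap P x₀ r ((1 - t) * δ) := by
      intro C hC hCc hn
      have h := hg C hC hCc hn
      rw [ENNReal.ofReal_mul (by linarith)]
      calc ENNReal.ofReal (1 - t) * ENNReal.ofReal δ
          ≤ ENNReal.ofReal (1 - t) * Q₀ Cᶜ := mul_le_mul_right h _
        _ ≤ P Cᶜ := by
          rw [hP, Measure.add_apply, Measure.smul_apply, smul_eq_mul]
          exact le_self_add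
    have hPb : Lprof P ≠ ⊥ := by rw [heq]; exact hnb
    obtain ⟨ψ, hψ, hψL⟩ := exists_MLE P hr (by nlinarith) (by nlinarith) hg' hPb
    rw [hmix ψ hψ, heq] at hψL
    have hl₀ := Lfun_le_Lprof hψ Q₀
    have hl₁ := Lfun_le_Lprof hψ Q₁
    obtain ⟨e₀, e₁⟩ := real_aux (by linarith) ht₀ hb₀ ht0 hb₁ ht1 hl₀ hl₁ hψL
    exact ⟨ψ, ⟨hψ, fun φ hφ => (Lfun_le_Lprof hφ Q₀).trans e₀⟩,
      ⟨hψ, fun φ hφ => (Lfun_le_Lprof hφ Q₁).trans e₁⟩⟩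
  · rintro ⟨-, -, ψ, m₀, m₁⟩
    have e₀ : Lprof Q₀ = Lfun ψ Q₀ :=
      le_antisymm (iSup₂_le fun φ hφ => m₀.2 φ hφ) (Lfun_le_Lprof m₀.1 Q₀)
    have e₁ : Lprof Q₁ = Lfun ψ Q₁ :=
      le_antisymm (iSup₂_le fun φ hφ => m₁.2 φ hφ) (Lfun_le_Lprof m₁.1 Q₁)
    have ht0 : Lprof Q₀ ≠ ⊤ := by rw [e₀]; exact Lfun_ne_top Q₀ m₀.1
    have ht1 : Lprof Q₁ ≠ ⊤ := by rw [e₁]; exact Lfun_ne_top Q₁ m₁.1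
    refine ⟨le_antisymm hle ?_, ?_⟩
    · rw [e₀, e₁, ← hmix ψ m₀.1]
      exact Lfun_le_Lprof m₀.1 P
    · lift Lprof Q₀ to ℝ using ⟨ht0, hb₀⟩ with A
      lift Lprof Q₁ to ℝ using ⟨ht1, hb₁⟩ with B
      rw [← EReal.coe_mul, ← EReal.coe_mul, ← EReal.coe_add]
      exact ⟨EReal.coe_ne_bot _, EReal.coe_ne_top _⟩
end
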